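/- Under the weakened hypothesis that h is continuous on I = [-a,b], positive on the open interval (-a,b) but allowed to vanish at the endpoints x = -a and x = b, and still satisfies conditions (i) and (ii) near x = 0, the two-term asymptotics persist: for every integer j ≥ 1, lim_{ε→0⁺} ε^{2α} ( λ_j(ε) − π²/(M² ε²) ) = μ_j. -/

import Mathlib

open MeasureTheory Real Filter Set

/-- `|∇ψ|² = (∂ₓψ)² + (∂_yψ)²` for a function `ψ : ℝ² → ℝ`. -/
noncomputable def gradSq (ψ : ℝ × ℝ → ℝ) (p : ℝ × ℝ) : ℝ :=
  (deriv (fun s => ψ (s, p.2)) p.1) ^ 2 + (deriv (fun t => ψ (p.1, t)) p.2) ^ 2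

/-- The `j`-th Courant–Fischer min–max value of the Dirichlet Laplacian on an open
set `Ω ⊆ ℝ²`: the infimum over `j`-dimensional subspaces `F` of `C_c^∞(Ω)` of the
supremum of the Rayleigh quotient over nonzero `ψ ∈ F`. -/
noncomputable def dirichletMinMax (Ω : Set (ℝ × ℝ)) (j : ℕ) : ℝ :=
  sInf { r : ℝ | ∃ F : Submodule ℝ ((ℝ × ℝ) → ℝ),
    Module.finrank ℝ F = j ∧
    (∀ ψ ∈ F, ContDiff ℝ (⊤ : ℕ∞) ψ ∧ HasCompactSupport ψ ∧ tsupport ψ ⊆ Ω) ∧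
    r = sSup { s : ℝ | ∃ ψ ∈ F, ψ ≠ (0 : (ℝ × ℝ) → ℝ) ∧
      s = (∫ p in Ω, gradSq ψ p) / (∫ p in Ω, (ψ p) ^ 2) } }

/-- The `j`-th min–max value of the Schrödinger operator `−d²/dx² + q` on `L²(ℝ)`. -/
noncomputable def schroedingerMinMax (q : ℝ → ℝ) (j : ℕ) : ℝ :=
  sInf { r : ℝ | ∃ F : Submodule ℝ (ℝ → ℝ),
    Module.finrank ℝ F = j ∧
    (∀ χ ∈ F, ContDiff ℝ (⊤ : ℕ∞) χ ∧ HasCompactSupport χ) ∧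
    r = sSup { s : ℝ | ∃ χ ∈ F, χ ≠ (0 : ℝ → ℝ) ∧
      s = (∫ x : ℝ, (deriv χ x ^ 2 + q x * χ x ^ 2)) / (∫ x : ℝ, χ x ^ 2) } }

noncomputable def dX (ψ : ℝ × ℝ → ℝ) (p : ℝ × ℝ) : ℝ := deriv (fun s => ψ (s, p.2)) p.1
noncomputable def dY (ψ : ℝ × ℝ → ℝ) (p : ℝ × ℝ) : ℝ := deriv (fun t => ψ (p.1, t)) p.2

lemma gradSq_eq (ψ : ℝ × ℝ → ℝ) : gradSq ψ = fun p => dX ψ p ^ 2 + dY ψ p ^ 2 := rfl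

/-- smooth compactly supported -/
def SC (ψ : ℝ × ℝ → ℝ) : Prop := ContDiff ℝ (⊤ : ℕ∞) ψ ∧ HasCompactSupport ψ

/-- smooth compactly supported, 1D -/
def SC1 (χ : ℝ → ℝ) : Prop := ContDiff ℝ (⊤ : ℕ∞) χ ∧ HasCompactSupport χ

lemma hasDerivAt_X {ψ : ℝ × ℝ → ℝ} (hψ : ContDiff ℝ (⊤ : ℕ∞) ψ) (x y : ℝ) :
    HasDerivAt (fun s => ψ (s, y)) (fderiv ℝ ψ (x, y) (1, 0)) x := by
  have h1 : HasFDerivAt ψ (fderiv ℝ ψ (x, y)) (x, y) :=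
    (hψ.differentiable (by simp)).differentiableAt.hasFDerivAt
  have h2 : HasDerivAt (fun s : ℝ => (s, y)) ((1 : ℝ), (0 : ℝ)) x :=
    (hasDerivAt_id x).prodMk (hasDerivAt_const x y)
  exact h1.comp_hasDerivAt x h2

lemma hasDerivAt_Y {ψ : ℝ × ℝ → ℝ} (hψ : ContDiff ℝ (⊤ : ℕ∞) ψ) (x y : ℝ) :
    HasDerivAt (fun s => ψ (x, s)) (fderiv ℝ ψ (x, y) (0, 1)) y := by
  have h1 : HasFDerivAt ψ (fderiv ℝ ψ (x, y)) (x, y) :=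
    (hψ.differentiable (by simp)).differentiableAt.hasFDerivAt
  have h2 : HasDerivAt (fun s : ℝ => (x, s)) ((0 : ℝ), (1 : ℝ)) y :=
    (hasDerivAt_const y x).prodMk (hasDerivAt_id y)
  exact h1.comp_hasDerivAt y h2

lemma dX_eq {ψ : ℝ × ℝ → ℝ} (hψ : ContDiff ℝ (⊤ : ℕ∞) ψ) :
    dX ψ = fun p => fderiv ℝ ψ p (1, 0) := by
  funext p; exact (hasDerivAt_X hψ p.1 p.2).deriv

lemma dY_eq {ψ : ℝ × ℝ → ℝ} (hψ : ContDiff ℝ (⊤ : ℕ∞) ψ) :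
    dY ψ = fun p => fderiv ℝ ψ p (0, 1) := by
  funext p; exact (hasDerivAt_Y hψ p.1 p.2).deriv

lemma hasDerivAt_dX {ψ : ℝ × ℝ → ℝ} (hψ : ContDiff ℝ (⊤ : ℕ∞) ψ) (x y : ℝ) :
    HasDerivAt (fun s => ψ (s, y)) (dX ψ (x, y)) x := by
  rw [dX_eq hψ]; exact hasDerivAt_X hψ x y

lemma hasDerivAt_dY {ψ : ℝ × ℝ → ℝ} (hψ : ContDiff ℝ (⊤ : ℕ∞) ψ) (x y : ℝ) :
    HasDerivAt (fun s => ψ (x, s)) (dY ψ (x, y)) y := by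
  rw [dY_eq hψ]; exact hasDerivAt_Y hψ x y

/-- full chain rule along a curve -/
lemma hasDerivAt_curve {ψ : ℝ × ℝ → ℝ} (hψ : ContDiff ℝ (⊤ : ℕ∞) ψ) {f g : ℝ → ℝ} {f' g' t : ℝ}
    (hf : HasDerivAt f f' t) (hg : HasDerivAt g g' t) :
    HasDerivAt (fun s => ψ (f s, g s)) (f' * dX ψ (f t, g t) + g' * dY ψ (f t, g t)) t := by
  have h1 : HasFDerivAt ψ (fderiv ℝ ψ (f t, g t)) (f t, g t) :=
    (hψ.differentiable (by simp)).differentiableAt.hasFDerivAt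
  have h2 := h1.comp_hasDerivAt t (hf.prodMk hg)
  have h3 : fderiv ℝ ψ (f t, g t) (f', g') =
      f' * dX ψ (f t, g t) + g' * dY ψ (f t, g t) := by
    rw [dX_eq hψ, dY_eq hψ]
    have : (f', g') = f' • ((1 : ℝ), (0 : ℝ)) + g' • ((0 : ℝ), (1 : ℝ)) := by
      ext <;> simp
    rw [this, map_add, map_smul, map_smul]; simp
  rw [← h3]; exact h2

lemma SC.dX {ψ : ℝ × ℝ → ℝ} (h : SC ψ) : SC (dX ψ) := by
  rw [dX_eq h.1]
  refine ⟨?_, ?_⟩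
  · have : ContDiff ℝ (⊤ : ℕ∞) (fderiv ℝ ψ) := h.1.fderiv_right (by simp)
    exact this.clm_apply contDiff_const
  · exact (h.2.fderiv ℝ).comp_left (g := fun L : (ℝ × ℝ) →L[ℝ] ℝ => L (1, 0)) (by simp)

lemma SC.dY {ψ : ℝ × ℝ → ℝ} (h : SC ψ) : SC (dY ψ) := by
  rw [dY_eq h.1]
  refine ⟨?_, ?_⟩
  · have : ContDiff ℝ (⊤ : ℕ∞) (fderiv ℝ ψ) := h.1.fderiv_right (by simp)
    exact this.clm_apply contDiff_const
  · exact (h.2.fderiv ℝ).comp_left (g := fun L : (ℝ × ℝ) →L[ℝ] ℝ => L (0, 1)) (by simp)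

lemma SC.cont {ψ : ℝ × ℝ → ℝ} (h : SC ψ) : Continuous ψ := h.1.continuous
lemma SC1.cont {χ : ℝ → ℝ} (h : SC1 χ) : Continuous χ := h.1.continuous

lemma dX_add {φ ψ : ℝ × ℝ → ℝ} (hφ : SC φ) (hψ : SC ψ) : dX (φ + ψ) = dX φ + dX ψ := by
  funext p
  exact ((hasDerivAt_dX hφ.1 p.1 p.2).add (hasDerivAt_dX hψ.1 p.1 p.2)).deriv
lemma dY_add {φ ψ : ℝ × ℝ → ℝ} (hφ : SC φ) (hψ : SC ψ) : dY (φ + ψ) = dY φ + dY ψ := by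
  funext p
  exact ((hasDerivAt_dY hφ.1 p.1 p.2).add (hasDerivAt_dY hψ.1 p.1 p.2)).deriv
lemma dX_smul {ψ : ℝ × ℝ → ℝ} (c : ℝ) (hψ : SC ψ) : dX (c • ψ) = c • dX ψ := by
  funext p
  exact ((hasDerivAt_dX hψ.1 p.1 p.2).const_mul c).deriv
lemma dY_smul {ψ : ℝ × ℝ → ℝ} (c : ℝ) (hψ : SC ψ) : dY (c • ψ) = c • dY ψ := by
  funext p
  exact ((hasDerivAt_dY hψ.1 p.1 p.2).const_mul c).deriv

lemma SC1.deriv {χ : ℝ → ℝ} (h : SC1 χ) : SC1 (deriv χ) := by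
  refine ⟨?_, h.2.deriv⟩
  have := h.1
  rw [show ((⊤ : ℕ∞) : WithTop ℕ∞) = (⊤ : ℕ∞) + 1 from rfl] at this
  exact (contDiff_succ_iff_deriv.1 this).2.2

lemma SC1.hasDerivAt {χ : ℝ → ℝ} (h : SC1 χ) (x : ℝ) : HasDerivAt χ (_root_.deriv χ x) x :=
  ((h.1.differentiable (by simp)) x).hasDerivAt

/-- integrability of continuous function times a compactly supported one -/
lemma integrable_mul_cs {X : Type*} [TopologicalSpace X] [MeasurableSpace X] [OpensMeasurableSpace X]
    {μ : Measure X} [IsFiniteMeasureOnCompacts μ] {f g : X → ℝ}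
    (hf : Continuous f) (hg : Continuous g) (hc : HasCompactSupport g) :
    Integrable (fun x => f x * g x) μ :=
  (hf.mul hg).integrable_of_hasCompactSupport hc.mul_left

lemma integrable_mul_sq {X : Type*} [TopologicalSpace X] [MeasurableSpace X]
    [OpensMeasurableSpace X]
    {μ : Measure X} [IsFiniteMeasureOnCompacts μ] {f g : X → ℝ}
    (hf : Continuous f) (hg : Continuous g) (hc : HasCompactSupport g) :
    Integrable (fun x => f x * g x ^ 2) μ := by
  have : (fun x => f x * g x ^ 2) = fun x => (f x * g x) * g x := by funext x; ring
  rw [this]; exact integrable_mul_cs (hf.mul hg) hg hc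

lemma integrable_sq_cs {X : Type*} [TopologicalSpace X] [MeasurableSpace X]
    [OpensMeasurableSpace X]
    {μ : Measure X} [IsFiniteMeasureOnCompacts μ] {g : X → ℝ}
    (hg : Continuous g) (hc : HasCompactSupport g) :
    Integrable (fun x => g x ^ 2) μ := by
  simpa using integrable_mul_sq (μ := μ) (f := fun _ => (1:ℝ)) continuous_const hg hc

lemma integral_sq_pos {X : Type*} [TopologicalSpace X] [MeasurableSpace X]
    [OpensMeasurableSpace X]
    {μ : Measure X} [IsFiniteMeasureOnCompacts μ] [μ.IsOpenPosMeasure] {g : X → ℝ}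
    (hg : Continuous g) (hc : HasCompactSupport g) (h0 : g ≠ 0) :
    0 < ∫ x, g x ^ 2 ∂μ := by
  obtain ⟨x, hx⟩ := Function.ne_iff.1 h0
  refine Continuous.integral_pos_of_hasCompactSupport_nonneg_nonzero (x := x) (hg.pow 2) ?_
    (fun x => sq_nonneg _) ?_
  · exact hc.comp_left (g := fun z : ℝ => z ^ 2) (by simp)
  · simpa using hx

lemma rayleigh_bound {V : Type*} [AddCommGroup V] [Module ℝ V] [FiniteDimensional ℝ V]
    (E N : V → V → ℝ)
    (E1 : ∀ u v w, E (u + v) w = E u w + E v w) (E2 : ∀ (c : ℝ) u v, E (c • u) v = c * E u v)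
    (E3 : ∀ u v w, E w (u + v) = E w u + E w v) (E4 : ∀ (c : ℝ) u v, E u (c • v) = c * E u v)
    (N1 : ∀ u v w, N (u + v) w = N u w + N v w) (N2 : ∀ (c : ℝ) u v, N (c • u) v = c * N u v)
    (N3 : ∀ u v w, N w (u + v) = N w u + N w v) (N4 : ∀ (c : ℝ) u v, N u (c • v) = c * N u v)
    (Npos : ∀ v, v ≠ 0 → 0 < N v v) :
    ∃ C : ℝ, ∀ v, v ≠ 0 → E v v / N v v ≤ C := by
  classical
  let e := (Module.finBasis ℝ V).equivFun.symm
  have cont : ∀ (B : V → V → ℝ), (∀ u v w, B (u + v) w = B u w + B v w) →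
      (∀ (c : ℝ) u v, B (c • u) v = c * B u v) → (∀ u v w, B w (u + v) = B w u + B w v) →
      (∀ (c : ℝ) u v, B u (c • v) = c * B u v) → Continuous (fun c => B (e c) (e c)) := by
    intro B B1 B2 B3 B4
    let L : V →ₗ[ℝ] V →ₗ[ℝ] ℝ := LinearMap.mk₂ ℝ B B1 B2 (fun u v w => B3 v w u) B4
    have : (fun c => B (e c) (e c)) = fun c => ∑ i, ∑ k, c i * (c k *
        B (Module.finBasis ℝ V i) (Module.finBasis ℝ V k)) := by
      funext c
      change L (e c) (e c) = _
      have : e c = ∑ i, c i • Module.finBasis ℝ V i := by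
        simp [e, Module.Basis.equivFun_symm_apply]
      rw [this]
      simp only [map_sum, LinearMap.sum_apply, map_smul, LinearMap.smul_apply, smul_eq_mul,
        Finset.mul_sum]
      rw [Finset.sum_comm]
      refine Finset.sum_congr rfl fun i _ => Finset.sum_congr rfl fun k _ => ?_
      simp only [L, LinearMap.mk₂_apply]
      ring
    rw [this]
    fun_prop
  have hE := cont E E1 E2 E3 E4
  have hN := cont N N1 N2 N3 N4
  have hcomp : IsCompact (Metric.sphere (0 : Fin (Module.finrank ℝ V) → ℝ) 1) :=
    isCompact_sphere _ _
  have hcont : ContinuousOn (fun c => E (e c) (e c) / N (e c) (e c))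
      (Metric.sphere (0 : Fin (Module.finrank ℝ V) → ℝ) 1) := by
    refine hE.continuousOn.div hN.continuousOn ?_
    intro c hc
    refine (Npos _ ?_).ne'
    intro h0
    have : c = 0 := by simpa using h0
    simp [this] at hc
  obtain ⟨C, hC⟩ := (hcomp.image_of_continuousOn hcont).bddAbove
  refine ⟨C, fun v hv => ?_⟩
  obtain ⟨c, rfl⟩ := e.surjective v
  have hc : c ≠ 0 := by rintro rfl; simp at hv
  have hcn : 0 < ‖c‖ := norm_pos_iff.2 hc
  have key : E (e c) (e c) / N (e c) (e c)
      = E (e (‖c‖⁻¹ • c)) (e (‖c‖⁻¹ • c)) / N (e (‖c‖⁻¹ • c)) (e (‖c‖⁻¹ • c)) := by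
    rw [map_smul, E2, E4, N2, N4]
    have := (Npos _ hv).ne'
    field_simp
  rw [key]
  apply hC
  refine ⟨‖c‖⁻¹ • c, ?_, rfl⟩
  simp [norm_smul, hcn.ne']

def Good2 (Ω : Set (ℝ × ℝ)) (j : ℕ) (A : ℝ) : Prop :=
  ∃ F : Submodule ℝ ((ℝ × ℝ) → ℝ), Module.finrank ℝ F = j ∧
    (∀ ψ ∈ F, SC ψ ∧ tsupport ψ ⊆ Ω) ∧ ∀ ψ ∈ F, ∫ p, gradSq ψ p ≤ A * ∫ p, ψ p ^ 2

def Good1 (q : ℝ → ℝ) (j : ℕ) (A : ℝ) : Prop :=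
  ∃ F : Submodule ℝ (ℝ → ℝ), Module.finrank ℝ F = j ∧
    (∀ χ ∈ F, SC1 χ) ∧
      ∀ χ ∈ F, ∫ x, (deriv χ x ^ 2 + q x * χ x ^ 2) ≤ A * ∫ x, χ x ^ 2

lemma setInt_grad {Ω : Set (ℝ × ℝ)} {ψ : ℝ × ℝ → ℝ} (hψ : SC ψ) (hs : tsupport ψ ⊆ Ω) :
    ∫ p in Ω, gradSq ψ p = ∫ p, gradSq ψ p := by
  apply setIntegral_eq_integral_of_forall_compl_eq_zero
  intro p hp
  have : fderiv ℝ ψ p = 0 := by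
    by_contra h0
    exact hp (hs (support_fderiv_subset ℝ h0))
  rw [gradSq_eq, dX_eq hψ.1, dY_eq hψ.1]; simp [this]

lemma setInt_sq {Ω : Set (ℝ × ℝ)} {ψ : ℝ × ℝ → ℝ} (hs : tsupport ψ ⊆ Ω) :
    ∫ p in Ω, ψ p ^ 2 = ∫ p, ψ p ^ 2 := by
  apply setIntegral_eq_integral_of_forall_compl_eq_zero
  intro p hp
  have : ψ p = 0 := by
    by_contra h0
    exact hp (hs (subset_tsupport _ h0))
  simp [this]

lemma exists_ne_of_finrank {X : Type*} [AddCommGroup X] [Module ℝ X] {F : Submodule ℝ X} {j : ℕ}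
    (hj : 1 ≤ j) (h : Module.finrank ℝ F = j) : ∃ ψ ∈ F, ψ ≠ 0 := by
  have : 0 < Module.finrank ℝ F := by omega
  have := Module.nontrivial_of_finrank_pos this
  obtain ⟨⟨x, hx⟩, h⟩ := exists_ne (0 : F)
  exact ⟨x, hx, by simpa using h⟩

lemma quot_nonneg2 (Ω : Set (ℝ × ℝ)) (ψ : ℝ × ℝ → ℝ) :
    0 ≤ (∫ p in Ω, gradSq ψ p) / (∫ p in Ω, (ψ p) ^ 2) :=
  div_nonneg (integral_nonneg fun p => by unfold gradSq; positivity)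
    (integral_nonneg fun p => sq_nonneg _)

lemma dirichlet_le {Ω : Set (ℝ × ℝ)} {j : ℕ} {A : ℝ} (hj : 1 ≤ j) (h : Good2 Ω j A) :
    dirichletMinMax Ω j ≤ A := by
  obtain ⟨F, hF, hS, hA⟩ := h
  have hbb : BddBelow { r : ℝ | ∃ F : Submodule ℝ ((ℝ × ℝ) → ℝ),
    Module.finrank ℝ F = j ∧
    (∀ ψ ∈ F, ContDiff ℝ (⊤ : ℕ∞) ψ ∧ HasCompactSupport ψ ∧ tsupport ψ ⊆ Ω) ∧
    r = sSup { s : ℝ | ∃ ψ ∈ F, ψ ≠ (0 : (ℝ × ℝ) → ℝ) ∧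
      s = (∫ p in Ω, gradSq ψ p) / (∫ p in Ω, (ψ p) ^ 2) } } := by
    refine ⟨0, ?_⟩
    rintro r ⟨F, -, -, rfl⟩
    apply Real.sSup_nonneg
    rintro s ⟨ψ, -, -, rfl⟩
    exact quot_nonneg2 _ _
  refine (csInf_le hbb ⟨F, hF, fun ψ hψ => ⟨(hS ψ hψ).1.1, (hS ψ hψ).1.2, (hS ψ hψ).2⟩, rfl⟩).trans ?_
  apply csSup_le
  · obtain ⟨ψ, hψ, h0⟩ := exists_ne_of_finrank hj hF
    exact ⟨_, ψ, hψ, h0, rfl⟩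
  · rintro s ⟨ψ, hψ, h0, rfl⟩
    rw [setInt_grad (hS ψ hψ).1 (hS ψ hψ).2, setInt_sq (hS ψ hψ).2]
    rw [div_le_iff₀ (integral_sq_pos (hS ψ hψ).1.cont (hS ψ hψ).1.2 h0)]
    exact hA ψ hψ

lemma schr_le {q : ℝ → ℝ} (hq : ∀ x, 0 ≤ q x) {j : ℕ} {A : ℝ} (hj : 1 ≤ j) (h : Good1 q j A) :
    schroedingerMinMax q j ≤ A := by
  obtain ⟨F, hF, hS, hA⟩ := h
  have hbb : BddBelow { r : ℝ | ∃ F : Submodule ℝ (ℝ → ℝ),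
    Module.finrank ℝ F = j ∧
    (∀ χ ∈ F, ContDiff ℝ (⊤ : ℕ∞) χ ∧ HasCompactSupport χ) ∧
    r = sSup { s : ℝ | ∃ χ ∈ F, χ ≠ (0 : ℝ → ℝ) ∧
      s = (∫ x : ℝ, (deriv χ x ^ 2 + q x * χ x ^ 2)) / (∫ x : ℝ, χ x ^ 2) } } := by
    refine ⟨0, ?_⟩
    rintro r ⟨F, -, -, rfl⟩
    apply Real.sSup_nonneg
    rintro s ⟨ψ, -, -, rfl⟩
    exact div_nonneg (integral_nonneg fun p => by have := hq p; positivity)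
      (integral_nonneg fun p => sq_nonneg _)
  refine (csInf_le hbb ⟨F, hF, hS, rfl⟩).trans ?_
  apply csSup_le
  · obtain ⟨ψ, hψ, h0⟩ := exists_ne_of_finrank hj hF
    exact ⟨_, ψ, hψ, h0, rfl⟩
  · rintro s ⟨ψ, hψ, h0, rfl⟩
    rw [div_le_iff₀ (integral_sq_pos (hS ψ hψ).cont (hS ψ hψ).2 h0)]
    exact hA ψ hψ

lemma SC.int_mul {f g : ℝ × ℝ → ℝ} (hf : SC f) (hg : SC g) : Integrable (fun p => f p * g p) :=
  integrable_mul_cs hf.cont hg.cont hg.2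

lemma dirichlet_lt {Ω : Set (ℝ × ℝ)} {j : ℕ} {A A₀ : ℝ} (hj : 1 ≤ j) (h₀ : Good2 Ω j A₀)
    (h : dirichletMinMax Ω j < A) : Good2 Ω j A := by
  obtain ⟨F, hF, hS, hA⟩ := h₀
  unfold dirichletMinMax at h
  obtain ⟨r, ⟨F, hF, hS, rfl⟩, hr⟩ := exists_lt_of_csInf_lt (by
    exact ⟨_, F, hF, fun ψ hψ => ⟨(hS ψ hψ).1.1, (hS ψ hψ).1.2, (hS ψ hψ).2⟩, rfl⟩) h
  have hS' : ∀ ψ ∈ F, SC ψ ∧ tsupport ψ ⊆ Ω := fun ψ hψ =>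
    ⟨⟨(hS ψ hψ).1, (hS ψ hψ).2.1⟩, (hS ψ hψ).2.2⟩
  refine ⟨F, hF, hS', ?_⟩
  have hfd : FiniteDimensional ℝ F := Module.finite_of_finrank_pos (by omega)
  have hsc : ∀ f : F, SC f.1 := fun f => (hS' f.1 f.2).1
  obtain ⟨C, hC⟩ := rayleigh_bound (V := F)
    (fun f g => ∫ p, (dX f.1 p * dX g.1 p + dY f.1 p * dY g.1 p))
    (fun f g => ∫ p, (f.1 p * g.1 p))
    (by
      intro u v w
      rw [← integral_add]
      · congr 1; funext p
        simp only [Submodule.coe_add, dX_add (hsc u) (hsc v), dY_add (hsc u) (hsc v), Pi.add_apply]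
        ring
      · exact ((hsc u).dX.int_mul (hsc w).dX).add ((hsc u).dY.int_mul (hsc w).dY)
      · exact ((hsc v).dX.int_mul (hsc w).dX).add ((hsc v).dY.int_mul (hsc w).dY))
    (by
      intro c u v
      rw [← integral_const_mul]
      congr 1; funext p
      simp only [Submodule.coe_smul, dX_smul c (hsc u), dY_smul c (hsc u), Pi.smul_apply,
        smul_eq_mul]
      ring)
    (by
      intro u v w
      rw [← integral_add]
      · congr 1; funext p
        simp only [Submodule.coe_add, dX_add (hsc u) (hsc v), dY_add (hsc u) (hsc v), Pi.add_apply]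
        ring
      · exact ((hsc w).dX.int_mul (hsc u).dX).add ((hsc w).dY.int_mul (hsc u).dY)
      · exact ((hsc w).dX.int_mul (hsc v).dX).add ((hsc w).dY.int_mul (hsc v).dY))
    (by
      intro c u v
      rw [← integral_const_mul]
      congr 1; funext p
      simp only [Submodule.coe_smul, dX_smul c (hsc v), dY_smul c (hsc v), Pi.smul_apply,
        smul_eq_mul]
      ring)
    (by
      intro u v w
      rw [← integral_add ((hsc u).int_mul (hsc w)) ((hsc v).int_mul (hsc w))]
      congr 1; funext p; simp; ring)
    (by
      intro c u v
      rw [← integral_const_mul]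
      congr 1; funext p; simp; ring)
    (by
      intro u v w
      rw [← integral_add ((hsc w).int_mul (hsc u)) ((hsc w).int_mul (hsc v))]
      congr 1; funext p; simp; ring)
    (by
      intro c u v
      rw [← integral_const_mul]
      congr 1; funext p; simp; ring)
    (by
      intro v hv
      have := integral_sq_pos (μ := volume) (hsc v).cont (hsc v).2 (by simpa using hv)
      simpa [sq] using this)
  intro ψ hψ
  by_cases h0 : ψ = 0
  · subst h0
    simp [gradSq]
  have hpos := integral_sq_pos (μ := volume) (hS' ψ hψ).1.cont (hS' ψ hψ).1.2 h0
  rw [← div_le_iff₀ hpos]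
  refine le_trans ?_ hr.le
  apply le_csSup
  · refine ⟨C, ?_⟩
    rintro s ⟨φ, hφ, h0, rfl⟩
    have := hC ⟨φ, hφ⟩ (by simpa using h0)
    rw [setInt_grad (hS' φ hφ).1 (hS' φ hφ).2, setInt_sq (hS' φ hφ).2, gradSq_eq]
    simpa only [sq] using this
  · exact ⟨ψ, hψ, h0, by rw [setInt_grad (hS' ψ hψ).1 (hS' ψ hψ).2, setInt_sq (hS' ψ hψ).2]⟩

lemma SC1.int_mul {f g : ℝ → ℝ} (hf : SC1 f) (hg : SC1 g) : Integrable (fun p => f p * g p) :=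
  integrable_mul_cs hf.cont hg.cont hg.2

lemma SC1.int_qmul {q f g : ℝ → ℝ} (hq : Continuous q) (hf : SC1 f) (hg : SC1 g) :
    Integrable (fun p => q p * f p * g p) :=
  integrable_mul_cs (hq.mul hf.cont) hg.cont hg.2

lemma deriv1_add {f g : ℝ → ℝ} (hf : SC1 f) (hg : SC1 g) : deriv (f + g) = deriv f + deriv g := by
  funext x; exact ((hf.hasDerivAt x).add (hg.hasDerivAt x)).deriv

lemma deriv1_smul {f : ℝ → ℝ} (c : ℝ) (hf : SC1 f) : deriv (c • f) = c • deriv f := by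
  funext x; exact ((hf.hasDerivAt x).const_mul c).deriv

lemma schr_bound {q : ℝ → ℝ} (hq : Continuous q) {F : Submodule ℝ (ℝ → ℝ)}
    [FiniteDimensional ℝ F] (hS : ∀ χ ∈ F, SC1 χ) :
    ∃ C, ∀ χ ∈ F, χ ≠ 0 →
      (∫ x : ℝ, (deriv χ x ^ 2 + q x * χ x ^ 2)) / (∫ x : ℝ, χ x ^ 2) ≤ C := by
  have hsc : ∀ f : F, SC1 f.1 := fun f => hS f.1 f.2
  obtain ⟨C, hC⟩ := rayleigh_bound (V := F)
    (fun f g => ∫ p, (deriv f.1 p * deriv g.1 p + q p * f.1 p * g.1 p))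
    (fun f g => ∫ p, (f.1 p * g.1 p))
    (by
      intro u v w
      rw [← integral_add]
      · congr 1; funext p
        simp only [Submodule.coe_add, deriv1_add (hsc u) (hsc v), Pi.add_apply]
        ring
      · exact ((hsc u).deriv.int_mul (hsc w).deriv).add ((hsc u).int_qmul hq (hsc w))
      · exact ((hsc v).deriv.int_mul (hsc w).deriv).add ((hsc v).int_qmul hq (hsc w)))
    (by
      intro c u v
      rw [← integral_const_mul]
      congr 1; funext p
      simp only [Submodule.coe_smul, deriv1_smul c (hsc u), Pi.smul_apply,
        smul_eq_mul]
      ring)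
    (by
      intro u v w
      rw [← integral_add]
      · congr 1; funext p
        simp only [Submodule.coe_add, deriv1_add (hsc u) (hsc v), Pi.add_apply]
        ring
      · exact ((hsc w).deriv.int_mul (hsc u).deriv).add ((hsc w).int_qmul hq (hsc u))
      · exact ((hsc w).deriv.int_mul (hsc v).deriv).add ((hsc w).int_qmul hq (hsc v)))
    (by
      intro c u v
      rw [← integral_const_mul]
      congr 1; funext p
      simp only [Submodule.coe_smul, deriv1_smul c (hsc v), Pi.smul_apply,
        smul_eq_mul]
      ring)
    (by
      intro u v w
      rw [← integral_add ((hsc u).int_mul (hsc w)) ((hsc v).int_mul (hsc w))]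
      congr 1; funext p; simp; ring)
    (by
      intro c u v
      rw [← integral_const_mul]
      congr 1; funext p; simp; ring)
    (by
      intro u v w
      rw [← integral_add ((hsc w).int_mul (hsc u)) ((hsc w).int_mul (hsc v))]
      congr 1; funext p; simp; ring)
    (by
      intro c u v
      rw [← integral_const_mul]
      congr 1; funext p; simp; ring)
    (by
      intro v hv
      have := integral_sq_pos (μ := volume) (hsc v).cont (hsc v).2 (by simpa using hv)
      simpa [sq] using this)
  refine ⟨C, fun χ hχ h0 => ?_⟩
  have := hC ⟨χ, hχ⟩ (by simpa using h0)
  simpa only [sq, mul_assoc] using this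

lemma schr_lt {q : ℝ → ℝ} (hq : Continuous q) {j : ℕ} {A A₀ : ℝ} (hj : 1 ≤ j)
    (h₀ : Good1 q j A₀) (h : schroedingerMinMax q j < A) : Good1 q j A := by
  obtain ⟨F, hF, hS, hA⟩ := h₀
  unfold schroedingerMinMax at h
  obtain ⟨r, ⟨F, hF, hS, rfl⟩, hr⟩ := exists_lt_of_csInf_lt (by
    exact ⟨_, F, hF, hS, rfl⟩) h
  refine ⟨F, hF, hS, ?_⟩
  have hfd : FiniteDimensional ℝ F := Module.finite_of_finrank_pos (by omega)
  obtain ⟨C, hC⟩ := schr_bound hq hS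
  intro ψ hψ
  by_cases h0 : ψ = 0
  · subst h0
    simp
  have hpos := integral_sq_pos (μ := volume) (SC1.cont (hS ψ hψ)) (hS ψ hψ).2 h0
  rw [← div_le_iff₀ hpos]
  refine le_trans ?_ hr.le
  apply le_csSup
  · refine ⟨C, ?_⟩
    rintro s ⟨φ, hφ, h0, rfl⟩
    exact hC φ hφ h0
  · exact ⟨ψ, hψ, h0, rfl⟩

lemma exists_good1 {q : ℝ → ℝ} (hq : Continuous q) {j : ℕ} (hj : 1 ≤ j) :
    ∃ A, Good1 q j A := by
  classical
  let b : ContDiffBump (0 : ℝ) := ⟨1/4, 1/2, by norm_num, by norm_num⟩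
  let f : Fin j → ℝ → ℝ := fun i x => b (x - i)
  have hf : ∀ i, SC1 (f i) := by
    intro i
    refine ⟨b.contDiff.comp (contDiff_id.sub contDiff_const), ?_⟩
    exact b.hasCompactSupport.comp_homeomorph (Homeomorph.subRight (i : ℝ))
  have hfe : ∀ i k : Fin j, f i (k : ℕ) = if i = k then 1 else 0 := by
    intro i k
    by_cases hik : i = k
    · subst hik
      have : b 0 = 1 := b.one_of_mem_closedBall (by simp [b.rIn_pos.le])
      simp [f, this]
    · simp only [f, hik, if_false]
      apply b.zero_of_le_dist
      rw [Real.dist_eq, sub_zero]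
      have h1 : (1 : ℤ) ≤ |((k : ℕ) : ℤ) - ((i : ℕ) : ℤ)| := by
        have : (k : ℕ) ≠ (i : ℕ) := fun h => hik (Fin.ext h.symm)
        exact Int.one_le_abs (by omega)
      have h2 : (1 : ℝ) ≤ |((k : ℕ) : ℝ) - ((i : ℕ) : ℝ)| := by exact_mod_cast h1
      change (1/2 : ℝ) ≤ _
      linarith
  have hli : LinearIndependent ℝ f := by
    rw [Fintype.linearIndependent_iff]
    intro g hg i
    have := congrFun hg ((i : ℕ) : ℝ)
    simpa [Finset.sum_apply, hfe] using this
  let F := Submodule.span ℝ (Set.range f)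
  have hF : Module.finrank ℝ F = j := by
    simpa using finrank_span_eq_card hli
  have hS : ∀ χ ∈ F, SC1 χ := by
    intro χ hχ
    refine Submodule.span_induction ?_ ?_ ?_ ?_ hχ
    · rintro _ ⟨i, rfl⟩; exact hf i
    · exact ⟨contDiff_const, HasCompactSupport.zero⟩
    · intro x y _ _ hx hy; exact ⟨hx.1.add hy.1, hx.2.add hy.2⟩
    · intro c x _ hx; exact ⟨contDiff_const.smul hx.1, hx.2.smul_left (f := fun _ => c)⟩
  have hfd : FiniteDimensional ℝ F := Module.finite_of_finrank_pos (by omega)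
  obtain ⟨C, hC⟩ := schr_bound hq hS
  refine ⟨C, F, hF, hS, fun χ hχ => ?_⟩
  by_cases h0 : χ = 0
  · subst h0; simp
  · have hpos := integral_sq_pos (μ := volume) (SC1.cont (hS χ hχ)) (hS χ hχ).2 h0
    rw [← div_le_iff₀ hpos]
    exact hC χ hχ h0

lemma int_eq_sym {f : ℝ → ℝ} (h0 : ∀ s, s ∉ Ioo (0:ℝ) 1 → f s = 0) :
    ∫ s in (-1:ℝ)..1, f s = ∫ s, f s := by
  rw [intervalIntegral.integral_of_le (by norm_num)]
  apply setIntegral_eq_integral_of_forall_compl_eq_zero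
  intro x hx
  apply h0
  intro hx'
  exact hx ⟨by linarith [hx'.1], hx'.2.le⟩

lemma deriv_zero_out {f : ℝ → ℝ} (hf : ContDiff ℝ 1 f)
    (h0 : ∀ s, s ∉ Ioo (0:ℝ) 1 → f s = 0) : ∀ s, s ∉ Ioo (0:ℝ) 1 → deriv f s = 0 := by
  intro s hs
  have hd : HasDerivAt f (deriv f s) s := ((hf.differentiable (by simp)) s).hasDerivAt
  rw [mem_Ioo, not_and_or, not_lt, not_lt] at hs
  rcases hs with hs | hs
  · have h1 : HasDerivWithinAt f (deriv f s) (Iic s) s := hd.hasDerivWithinAt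
    have h2 : HasDerivWithinAt f 0 (Iic s) s := by
      refine (hasDerivWithinAt_const s (Iic s) (0:ℝ)).congr ?_ ?_
      · intro x hx; exact h0 x (fun h => by have := h.1; simp at hx; linarith)
      · exact h0 s (fun h => by have := h.1; linarith)
    exact (uniqueDiffWithinAt_Iic s).eq_deriv _ h1 h2
  · have h1 : HasDerivWithinAt f (deriv f s) (Ici s) s := hd.hasDerivWithinAt
    have h2 : HasDerivWithinAt f 0 (Ici s) s := by
      refine (hasDerivWithinAt_const s (Ici s) (0:ℝ)).congr ?_ ?_
      · intro x hx; exact h0 x (fun h => by have := h.2; simp at hx; linarith)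
      · exact h0 s (fun h => by have := h.2; linarith)
    exact (uniqueDiffWithinAt_Ici s).eq_deriv _ h1 h2

/-- Parseval for the sum `f(s) ± f(-s)`. -/
lemma parseval_sym {f : ℝ → ℝ} (hf : Continuous f) (h0 : ∀ s, s ∉ Ioo (0:ℝ) 1 → f s = 0)
    (c : ℝ) (hc : c ^ 2 = 1) (hab : (-1:ℝ) < 1) :
    HasSum (fun n => ‖fourierCoeffOn hab (fun s => ((f s + c * f (-s) : ℝ) : ℂ)) n‖ ^ 2)
      (∫ s, f s ^ 2) := by
  have hcont : Continuous (fun s => ((f s + c * f (-s) : ℝ) : ℂ)) := by fun_prop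
  have hm : MemLp (fun s => ((f s + c * f (-s) : ℝ) : ℂ)) 2 (volume.restrict (Ioc (-1:ℝ) 1)) := by
    have : MemLp (fun s => ((f s + c * f (-s) : ℝ) : ℂ)) 2 (volume.restrict (Icc (-1:ℝ) 1)) := by
      have : IsFiniteMeasure (volume.restrict (Icc (-1:ℝ) 1)) :=
        ⟨by simp⟩
      obtain ⟨C, hC⟩ := (isCompact_Icc (a := (-1:ℝ)) (b := 1)).exists_bound_of_continuousOn
        hcont.continuousOn
      refine MemLp.of_bound hcont.aestronglyMeasurable C ?_
      exact (ae_restrict_iff' measurableSet_Icc).2 (Eventually.of_forall hC)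
    exact this.mono_measure (Measure.restrict_mono Ioc_subset_Icc_self le_rfl)
  have := hasSum_sq_fourierCoeffOn hab hm
  convert this using 1
  have e : ∀ s, ‖((f s + c * f (-s) : ℝ) : ℂ)‖ ^ 2 = f s ^ 2 + f (-s) ^ 2 := by
    intro s
    rw [Complex.norm_real, Real.norm_eq_abs, sq_abs]
    have : f s * f (-s) = 0 := by
      by_cases hs : 0 < s
      · rw [h0 (-s) (fun h => by have := h.1; linarith)]; ring
      · rw [h0 s (fun h => hs h.1)]; ring
    linear_combination (2 * c) * this + (f (-s))^2 * hc
  simp_rw [e]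
  have i1 : IntervalIntegrable (fun s => f s ^ 2) volume (-1) 1 := (hf.pow 2).intervalIntegrable _ _
  have i2 : IntervalIntegrable (fun s => f (-s) ^ 2) volume (-1) 1 :=
    ((hf.comp continuous_neg).pow 2).intervalIntegrable _ _
  rw [intervalIntegral.integral_add i1 i2]
  rw [intervalIntegral.integral_comp_neg (fun s => f s ^ 2)]
  rw [neg_neg, int_eq_sym (f := fun s => f s ^ 2) (fun s hs => by simp [h0 s hs])]
  rw [smul_eq_mul]; ring

lemma coeff_odd {f : ℝ → ℝ} (hf : Continuous f) (h0 : ∀ s, s ∉ Ioo (0:ℝ) 1 → f s = 0)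
    (hab : (-1:ℝ) < 1) (n : ℤ) :
    ‖fourierCoeffOn hab (fun s => ((f s + (-1) * f (-s) : ℝ) : ℂ)) n‖ ^ 2
      = (∫ s, f s * sin (n * (π * s))) ^ 2 := by
  have key : fourierCoeffOn hab (fun s => ((f s + (-1) * f (-s) : ℝ) : ℂ)) n
      = -Complex.I * ((∫ s, f s * sin (n * (π * s)) : ℝ) : ℂ) := by
    rw [fourierCoeffOn_eq_integral]
    have e : ∀ x : ℝ, (fourier (-n)) (x : AddCircle ((1:ℝ) - -1))
        = Complex.exp (-(n * (π * x) : ℝ) * Complex.I) := by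
      intro x
      rw [fourier_coe_apply]
      congr 1
      push_cast
      field_simp
      ring
    simp_rw [e, smul_eq_mul]
    have e2 : ∀ x : ℝ, Complex.exp (-(n * (π * x) : ℝ) * Complex.I) *
        ((f x + (-1) * f (-x) : ℝ) : ℂ) =
        Complex.exp (-(n * (π * x) : ℝ) * Complex.I) * (f x : ℂ)
        - Complex.exp ((n * (π * (-x)) : ℝ) * Complex.I) * (f (-x) : ℂ) := by
      intro x
      have : (-(n * (π * x) : ℝ) * Complex.I) = ((n * (π * (-x)) : ℝ) * Complex.I) := by
        push_cast; ring
      rw [this]; push_cast; ring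
    simp_rw [e2]
    have c1 : Continuous fun x : ℝ => Complex.exp (-(n * (π * x) : ℝ) * Complex.I) * (f x : ℂ) := by
      fun_prop
    have c2 : Continuous fun x : ℝ => Complex.exp ((n * (π * x) : ℝ) * Complex.I) * (f x : ℂ) := by
      fun_prop
    have c3 : Continuous fun x : ℝ =>
      Complex.exp ((n * (π * (-x)) : ℝ) * Complex.I) * (f (-x) : ℂ) := by fun_prop
    rw [intervalIntegral.integral_sub (c1.intervalIntegrable _ _) (c3.intervalIntegrable _ _)]
    rw [intervalIntegral.integral_comp_neg
      (fun x => Complex.exp ((n * (π * x) : ℝ) * Complex.I) * (f x : ℂ)), neg_neg,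
      ← intervalIntegral.integral_sub (c1.intervalIntegrable _ _) (c2.intervalIntegrable _ _)]
    have e3 : ∀ x : ℝ, Complex.exp (-(n * (π * x) : ℝ) * Complex.I) * (f x : ℂ)
        - Complex.exp ((n * (π * x) : ℝ) * Complex.I) * (f x : ℂ)
        = (-2 * Complex.I) * ((f x * sin (n * (π * x)) : ℝ) : ℂ) := by
      intro x
      push_cast
      rw [Complex.sin]
      have := Complex.I_sq
      linear_combination ((f x : ℂ) * (Complex.exp (-(n * (π * x)) * Complex.I)
        - Complex.exp ((n * (π * x)) * Complex.I))) * this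
    simp_rw [e3]
    rw [intervalIntegral.integral_const_mul, intervalIntegral.integral_ofReal,
      int_eq_sym (f := fun x => f x * sin (n * (π * x))) (fun s hs => by simp [h0 s hs])]
    rw [Complex.real_smul]; push_cast; ring
  rw [key, norm_mul, norm_neg, Complex.norm_I, one_mul, Complex.norm_real, Real.norm_eq_abs, sq_abs]

lemma coeff_deriv {f : ℝ → ℝ} (hf : ContDiff ℝ 1 f) (h0 : ∀ s, s ∉ Ioo (0:ℝ) 1 → f s = 0)
    (hab : (-1:ℝ) < 1) (n : ℤ) (hn : n ≠ 0) :
    ‖fourierCoeffOn hab (fun s => ((deriv f s + 1 * deriv f (-s) : ℝ) : ℂ)) n‖ ^ 2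
      = π ^ 2 * n ^ 2 * ‖fourierCoeffOn hab (fun s => ((f s + (-1) * f (-s) : ℝ) : ℂ)) n‖ ^ 2 := by
  have hd : ∀ s, HasDerivAt f (deriv f s) s := fun s =>
    ((hf.differentiable (by simp)) s).hasDerivAt
  have hcd : Continuous (deriv f) := hf.continuous_deriv (by simp)
  have h1 := fourierCoeffOn_of_hasDerivAt hab (f := (fun s => ((f s + (-1) * f (-s) : ℝ) : ℂ)))
    (f' := (fun s => ((deriv f s + 1 * deriv f (-s) : ℝ) : ℂ))) (n := n) hn
    (by
      intro x _
      apply HasDerivAt.ofReal_comp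
      have := (hd x).add ((((hd (-x)).scomp x (hasDerivAt_neg x))).const_mul (-1))
      have e : deriv f x + 1 * deriv f (-x) = deriv f x + -1 * ((-1 : ℝ) • deriv f (-x)) := by
        rw [smul_eq_mul]; ring
      rw [e]
      exact this)
    (by
      apply Continuous.intervalIntegrable
      fun_prop)
  have z1 : f 1 = 0 := h0 1 (by simp)
  have z2 : f (-1) = 0 := h0 (-1) (by simp)
  simp only [z1, z2, neg_neg] at h1
  have h2 : fourierCoeffOn hab (fun s => ((deriv f s + 1 * deriv f (-s) : ℝ) : ℂ)) n
      = (π * n : ℝ) * (Complex.I *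
        fourierCoeffOn hab (fun s => ((f s + (-1) * f (-s) : ℝ) : ℂ)) n) := by
    rw [h1]
    have : (π : ℂ) ≠ 0 := by exact_mod_cast pi_ne_zero
    have : (n : ℂ) ≠ 0 := by exact_mod_cast hn
    push_cast
    field_simp
    norm_num
  rw [h2, norm_mul, norm_mul, Complex.norm_I, Complex.norm_real, Real.norm_eq_abs, mul_pow, sq_abs]
  ring

lemma fiber_main {f : ℝ → ℝ} (hf : ContDiff ℝ 1 f) (h0 : ∀ s, s ∉ Ioo (0:ℝ) 1 → f s = 0) :
    2 * (∫ s, f s * sin (π * s)) ^ 2 ≤ ∫ s, f s ^ 2 ∧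
    4 * π ^ 2 * (∫ s, f s ^ 2) - 6 * π ^ 2 * (∫ s, f s * sin (π * s)) ^ 2 ≤ ∫ s, deriv f s ^ 2 := by
  have hab : (-1:ℝ) < 1 := by norm_num
  have P1 := parseval_sym hf.continuous h0 (-1) (by norm_num) hab
  have P2 := parseval_sym (hf.continuous_deriv (by simp)) (deriv_zero_out hf h0) 1 (by norm_num) hab
  set c := fun n => ‖fourierCoeffOn hab (fun s => ((f s + (-1) * f (-s) : ℝ) : ℂ)) n‖ ^ 2 with hc
  set d := fun n => ‖fourierCoeffOn hab (fun s => ((deriv f s + 1 * deriv f (-s) : ℝ) : ℂ)) n‖ ^ 2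
    with hd
  have c1 : c 1 = (∫ s, f s * sin (π * s)) ^ 2 := by
    rw [hc]; simp only; rw [coeff_odd hf.continuous h0 hab 1]; simp
  have cm1 : c (-1) = (∫ s, f s * sin (π * s)) ^ 2 := by
    rw [hc]; simp only; rw [coeff_odd hf.continuous h0 hab (-1)]
    simp [integral_neg]
  have c0 : c 0 = 0 := by
    rw [hc]; simp only; rw [coeff_odd hf.continuous h0 hab 0]; simp
  have cn : ∀ n, 0 ≤ c n := fun n => sq_nonneg _
  have dn : ∀ n, 0 ≤ d n := fun n => sq_nonneg _
  have dc : ∀ n : ℤ, n ≠ 0 → d n = π ^ 2 * n ^ 2 * c n := fun n hn => coeff_deriv hf h0 hab n hn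
  have fin : HasSum (fun n : ℤ => if n ∈ ({1, -1} : Finset ℤ) then c n else 0)
      (∑ n ∈ ({1, -1} : Finset ℤ), c n) := by
    have := hasSum_sum_of_ne_finset_zero (f := fun n : ℤ => if n ∈ ({1, -1} : Finset ℤ) then c n else 0)
      (s := {1, -1}) (L := SummationFilter.unconditional ℤ) (by intro b hb; simp only [hb, if_false])
    convert this using 1
    exact Finset.sum_congr rfl fun n hn => by simp only [hn, if_true]
  have fs : (∑ n ∈ ({1, -1} : Finset ℤ), c n) = 2 * (∫ s, f s * sin (π * s)) ^ 2 := by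
    rw [Finset.sum_pair (by norm_num), c1, cm1]; ring
  rw [fs] at fin
  constructor
  · refine hasSum_le ?_ fin P1
    intro n
    split_ifs
    · exact le_rfl
    · exact cn n
  · have Q := (P1.mul_left (4 * π ^ 2)).sub (fin.mul_left (3 * π ^ 2))
    have : 4 * π ^ 2 * (∫ s, f s ^ 2) - 6 * π ^ 2 * (∫ s, f s * sin (π * s)) ^ 2
      = 4 * π ^ 2 * (∫ s, f s ^ 2) - 3 * π ^ 2 * (2 * (∫ s, f s * sin (π * s)) ^ 2) := by ring
    rw [this]
    refine hasSum_le ?_ Q P2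
    intro n
    by_cases hn : n ∈ ({1, -1} : Finset ℤ)
    · simp only [hn, if_true]
      have hn0 : n ≠ 0 := by rintro rfl; simp at hn
      have hn2 : (n : ℝ) ^ 2 = 1 := by
        simp at hn; rcases hn with rfl | rfl <;> simp
      rw [dc n hn0, hn2]; linarith
    · simp only [hn, if_false]
      by_cases hn0 : n = 0
      · subst hn0; rw [c0]; simpa using dn 0
      · rw [dc n hn0]
        have : (4 : ℝ) ≤ (n : ℝ) ^ 2 := by
          have h3 : n ≤ -2 ∨ 2 ≤ n := by simp at hn; omega
          have : (4 : ℤ) ≤ n ^ 2 := by rcases h3 with h3 | h3 <;> nlinarith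
          exact_mod_cast this
        have h5 : 0 ≤ π ^ 2 * c n := mul_nonneg (sq_nonneg _) (cn n)
        nlinarith

lemma poincare01 {f : ℝ → ℝ} (hf : ContDiff ℝ 1 f) (h0 : ∀ s, s ∉ Ioo (0:ℝ) 1 → f s = 0) :
    π ^ 2 * (∫ s, f s ^ 2) ≤ ∫ s, deriv f s ^ 2 := by
  obtain ⟨h1, h2⟩ := fiber_main hf h0
  have : 0 < π ^ 2 := by positivity
  nlinarith

lemma poincareL {f : ℝ → ℝ} (hf : ContDiff ℝ 1 f) {L : ℝ} (hL : 0 < L)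
    (h0 : ∀ s, s ∉ Ioo (0:ℝ) L → f s = 0) :
    π ^ 2 / L ^ 2 * (∫ s, f s ^ 2) ≤ ∫ s, deriv f s ^ 2 := by
  have hd : ∀ s, HasDerivAt f (deriv f s) s := fun s =>
    ((hf.differentiable (by simp)) s).hasDerivAt
  have h1 := poincare01 (f := fun s => f (L * s)) (hf.comp (contDiff_const.mul contDiff_id)) (by
    intro s hs
    apply h0
    intro h
    apply hs
    refine ⟨by have := h.1; exact pos_of_mul_pos_right this hL.le, ?_⟩
    have := h.2
    by_contra h'
    push Not at h'
    nlinarith)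
  have e : deriv (fun s => f (L * s)) = fun s => L * deriv f (L * s) := by
    funext s
    have := (hd (L * s)).comp s ((hasDerivAt_id s).const_mul L)
    have h2 : HasDerivAt (fun s => f (L * s)) (deriv f (L * s) * (L * 1)) s := this
    rw [h2.deriv]; ring
  rw [e] at h1
  simp only [mul_pow] at h1
  rw [integral_const_mul, Measure.integral_comp_mul_left (fun s => f s ^ 2),
    Measure.integral_comp_mul_left (fun s => deriv f s ^ 2)] at h1
  rw [abs_of_pos (by positivity : 0 < L⁻¹)] at h1
  simp only [smul_eq_mul] at h1
  rw [div_mul_eq_mul_div, div_le_iff₀ (by positivity)]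
  have h2 := mul_le_mul_of_nonneg_left h1 hL.le
  have e1 : L * (π ^ 2 * (L⁻¹ * ∫ s, f s ^ 2)) = π ^ 2 * ∫ s, f s ^ 2 := by field_simp
  have e2 : L * (L ^ 2 * (L⁻¹ * ∫ s, deriv f s ^ 2)) = (∫ s, deriv f s ^ 2) * L ^ 2 := by field_simp
  rwa [e1, e2] at h2

noncomputable def Phi (A L : ℝ) (hA : 0 < A) (hL : 0 < L) (w : ℝ → ℝ) (hw : Continuous w) :
    ℝ × ℝ ≃ₜ ℝ × ℝ where
  toFun p := (A * p.1, L * exp (-w p.1) * p.2)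
  invFun p := (p.1 / A, p.2 * exp (w (p.1 / A)) / L)
  left_inv p := by
    ext
    · simp; field_simp
    · simp only
      rw [mul_div_cancel_left₀ _ hA.ne', exp_neg]
      have := (exp_pos (w p.1)).ne'
      field_simp
  right_inv p := by
    ext
    · simp; field_simp
    · simp only
      rw [exp_neg]
      have := (exp_pos (w (p.1 / A))).ne'
      field_simp
  continuous_toFun := by fun_prop
  continuous_invFun := by fun_prop

noncomputable def trf (A L : ℝ) (w : ℝ → ℝ) (ψ : ℝ × ℝ → ℝ) : ℝ × ℝ → ℝ :=
  fun p => exp (-(w p.1) / 2) * ψ (A * p.1, L * exp (-w p.1) * p.2)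

noncomputable def itrf (A L : ℝ) (w : ℝ → ℝ) (u : ℝ × ℝ → ℝ) : ℝ × ℝ → ℝ :=
  fun p => exp (w (p.1 / A) / 2) * u (p.1 / A, p.2 * exp (w (p.1 / A)) / L)


lemma SC.trf_sc {A L : ℝ} (hA : 0 < A) (hL : 0 < L) {w : ℝ → ℝ} (hw : ContDiff ℝ (⊤ : ℕ∞) w)
    {ψ : ℝ × ℝ → ℝ} (hψ : SC ψ) : SC (trf A L w ψ) := by
  constructor
  · unfold trf
    apply ContDiff.mul
    · apply Real.contDiff_exp.comp
      exact ((hw.comp contDiff_fst).neg).div_const _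
    · apply hψ.1.comp
      apply ContDiff.prodMk
      · exact contDiff_const.mul contDiff_fst
      · exact (contDiff_const.mul (Real.contDiff_exp.comp (hw.comp contDiff_fst).neg)).mul contDiff_snd
  · have := hψ.2.comp_homeomorph (Phi A L hA hL w hw.continuous)
    have h2 : HasCompactSupport ((fun p : ℝ × ℝ => exp (-(w p.1) / 2)) *
      (ψ ∘ Phi A L hA hL w hw.continuous)) := this.mul_left
    exact h2

lemma SC.itrf_sc {A L : ℝ} (hA : 0 < A) (hL : 0 < L) {w : ℝ → ℝ} (hw : ContDiff ℝ (⊤ : ℕ∞) w)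
    {ψ : ℝ × ℝ → ℝ} (hψ : SC ψ) : SC (itrf A L w ψ) := by
  constructor
  · unfold itrf
    have h1 : ContDiff ℝ (⊤ : ℕ∞) (fun p : ℝ × ℝ => w (p.1 / A)) :=
      hw.comp (contDiff_fst.div_const _)
    apply ContDiff.mul
    · exact Real.contDiff_exp.comp (h1.div_const _)
    · apply hψ.1.comp
      apply ContDiff.prodMk
      · exact contDiff_fst.div_const _
      · exact (contDiff_snd.mul (Real.contDiff_exp.comp h1)).div_const _
  · have := hψ.2.comp_homeomorph (Phi A L hA hL w hw.continuous).symm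
    have h2 : HasCompactSupport ((fun p : ℝ × ℝ => exp (w (p.1 / A) / 2)) *
      (ψ ∘ (Phi A L hA hL w hw.continuous).symm)) := this.mul_left
    exact h2

lemma trans_itrans {A L : ℝ} (hA : 0 < A) (hL : 0 < L) {w : ℝ → ℝ} (u : ℝ × ℝ → ℝ) : trf A L w (itrf A L w u) = u := by
  funext p
  simp only [trf, itrf]
  rw [mul_div_cancel_left₀ _ hA.ne', ← mul_assoc, ← exp_add]
  have e1 : -w p.1 / 2 + w p.1 / 2 = 0 := by ring
  have e2 : L * exp (-w p.1) * p.2 * exp (w p.1) / L = p.2 := by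
    rw [exp_neg]
    have := (exp_pos (w p.1)).ne'
    field_simp
  rw [e1, e2, exp_zero, one_mul]

lemma cov {A L : ℝ} (hA : 0 < A) (hL : 0 < L) {w : ℝ → ℝ} (hw : ContDiff ℝ (⊤ : ℕ∞) w)
    {f : ℝ × ℝ → ℝ} (hf : Continuous f) (hc : HasCompactSupport f) :
    ∫ p, f p = A * L * ∫ p : ℝ × ℝ, exp (-w p.1) * f (A * p.1, L * exp (-w p.1) * p.2) := by
  have hwc := hw.continuous
  have i1 : Integrable f (volume.prod volume) := hf.integrable_of_hasCompactSupport hc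
  have i2 : Integrable (fun p : ℝ × ℝ => exp (-w p.1) * f (A * p.1, L * exp (-w p.1) * p.2))
      (volume.prod volume) := by
    apply integrable_mul_cs
    · fun_prop
    · fun_prop
    · exact hc.comp_homeomorph (Phi A L hA hL w hw.continuous)
  rw [show (volume : Measure (ℝ × ℝ)) = volume.prod volume from rfl]
  rw [integral_prod _ i1, integral_prod _ i2]
  have e1 : ∀ t : ℝ, ∫ s, exp (-w t) * f (A * t, L * exp (-w t) * s)
      = L⁻¹ * ∫ y, f (A * t, y) := by
    intro t
    rw [integral_const_mul, Measure.integral_comp_mul_left (fun y => f (A * t, y))]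
    have : 0 < (L * exp (-w t))⁻¹ := by positivity
    rw [abs_of_pos this, smul_eq_mul]
    have := (exp_pos (-w t)).ne'
    field_simp
  simp only [e1]
  rw [integral_const_mul, Measure.integral_comp_mul_left (fun x => ∫ y, f (x, y)),
    abs_of_pos (by positivity), smul_eq_mul]
  field_simp

lemma trans_norm {A L : ℝ} (hA : 0 < A) (hL : 0 < L) {w : ℝ → ℝ} (hw : ContDiff ℝ (⊤ : ℕ∞) w)
    {ψ : ℝ × ℝ → ℝ} (hψ : SC ψ) : ∫ p, ψ p ^ 2 = A * L * ∫ p, (trf A L w ψ p) ^ 2 := by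
  rw [cov hA hL hw (f := fun p => ψ p ^ 2) (hψ.cont.pow 2)
    (hψ.2.comp_left (g := fun z : ℝ => z ^ 2) (by simp))]
  congr 2
  funext p
  simp only [trf, mul_pow]
  rw [← exp_nat_mul]
  congr 2
  push_cast; ring

lemma trans_dY {A L : ℝ} {w : ℝ → ℝ} {ψ : ℝ × ℝ → ℝ} (hψ : SC ψ) (t s : ℝ) : dY (trf A L w ψ) (t, s)
    = exp (-(w t) / 2) * (L * exp (-w t) * dY ψ (A * t, L * exp (-w t) * s)) := by
  have h1 : HasDerivAt (fun s => L * exp (-w t) * s) (L * exp (-w t)) s := by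
    simpa using (hasDerivAt_id s).const_mul (L * exp (-w t))
  have h2 := (hasDerivAt_curve hψ.1 (hasDerivAt_const s (A * t)) h1).const_mul (exp (-(w t) / 2))
  have h3 : HasDerivAt (fun s => trf A L w ψ (t, s)) _ s := h2
  rw [show dY (trf A L w ψ) (t, s) = _ from h3.deriv]
  ring

lemma trans_dX {A L : ℝ} {w : ℝ → ℝ} (hw : ContDiff ℝ (⊤ : ℕ∞) w) {ψ : ℝ × ℝ → ℝ} (hψ : SC ψ) (t s : ℝ) : dX (trf A L w ψ) (t, s)
    = exp (-(w t) / 2) * (A * dX ψ (A * t, L * exp (-w t) * s))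
      - deriv w t * (trf A L w ψ (t, s) / 2 + s * dY (trf A L w ψ) (t, s)) := by
  rw [trans_dY hψ]
  have hwd : HasDerivAt w (deriv w t) t := ((hw.differentiable (by simp)) t).hasDerivAt
  have h1 : HasDerivAt (fun t => L * exp (-w t) * s) (L * (exp (-w t) * (-deriv w t)) * s) t :=
    ((hwd.neg.exp).const_mul L).mul_const s
  have h0 : HasDerivAt (fun t => A * t) A t := by
    simpa using (hasDerivAt_id t).const_mul A
  have h4 : HasDerivAt (fun t => exp (-(w t) / 2)) (exp (-(w t) / 2) * (-deriv w t / 2)) t :=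
    (hwd.neg.div_const 2).exp
  have h2 := h4.mul (hasDerivAt_curve hψ.1 h0 h1)
  have h3 : HasDerivAt (fun t => trf A L w ψ (t, s)) _ t := h2
  rw [show dX (trf A L w ψ) (t, s) = _ from h3.deriv]
  simp only [trf]
  ring

lemma trans_Xenergy {A L : ℝ} (hA : 0 < A) (hL : 0 < L) {w : ℝ → ℝ} (hw : ContDiff ℝ (⊤ : ℕ∞) w)
    {ψ : ℝ × ℝ → ℝ} (hψ : SC ψ) : ∫ p, dX ψ p ^ 2 = A * L * ∫ p : ℝ × ℝ, (A ^ 2)⁻¹ *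
    (dX (trf A L w ψ) p + deriv w p.1 * (trf A L w ψ p / 2 + p.2 * dY (trf A L w ψ) p)) ^ 2 := by
  rw [cov hA hL hw (f := fun p => dX ψ p ^ 2) (hψ.dX.cont.pow 2)
    (hψ.dX.2.comp_left (g := fun z : ℝ => z ^ 2) (by simp))]
  congr 2
  funext ⟨t, s⟩
  rw [trans_dX hw hψ t s]
  simp only [sub_add_cancel, mul_pow]
  rw [← exp_nat_mul]
  have : exp (-w t) = exp ((2 : ℕ) * (-w t / 2)) := by congr 1; push_cast; ring
  rw [← this]
  field_simp

lemma trans_Yenergy {A L : ℝ} (hA : 0 < A) (hL : 0 < L) {w : ℝ → ℝ} (hw : ContDiff ℝ (⊤ : ℕ∞) w)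
    {ψ : ℝ × ℝ → ℝ} (hψ : SC ψ) : ∫ p, dY ψ p ^ 2 = A * L * ∫ p : ℝ × ℝ, (L ^ 2)⁻¹ *
    (exp (2 * w p.1) * dY (trf A L w ψ) p ^ 2) := by
  rw [cov hA hL hw (f := fun p => dY ψ p ^ 2) (hψ.dY.cont.pow 2)
    (hψ.dY.2.comp_left (g := fun z : ℝ => z ^ 2) (by simp))]
  congr 2
  funext ⟨t, s⟩
  rw [trans_dY hψ t s]
  simp only [mul_pow]
  rw [← exp_nat_mul, ← exp_nat_mul]
  have : exp (-w t) = exp (2 * w t) * (exp ((2:ℕ) * (-w t / 2)) * exp ((2:ℕ) * -w t)) := by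
    rw [← exp_add, ← exp_add]; congr 1; push_cast; ring
  rw [this]
  field_simp

lemma prod_SC {χ g : ℝ → ℝ} (hχ : SC1 χ) (hg : SC1 g) : SC (fun p : ℝ × ℝ => χ p.1 * g p.2) := by
  constructor
  · exact (hχ.1.comp contDiff_fst).mul (hg.1.comp contDiff_snd)
  · apply HasCompactSupport.intro (hχ.2.isCompact.prod hg.2.isCompact)
    intro p hp
    by_contra h
    apply hp
    exact ⟨subset_tsupport _ (fun h0 => h (by simp [h0])),
      subset_tsupport _ (fun h0 => h (by simp [h0]))⟩

set_option maxHeartbeats 1000000 in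
lemma upper_core {Ω : Set (ℝ × ℝ)} {q w g : ℝ → ℝ} {A L R Λ κ δ₁ δ₂ : ℝ} {j : ℕ}
    (hA : 0 < A) (hL : 0 < L) (hw : ContDiff ℝ (⊤ : ℕ∞) w) (hq : Continuous q)
    (hq0 : ∀ x, 0 ≤ q x) (hκ : 0 ≤ κ) (hδ₁ : δ₁ ≤ 1)
    (hwκ : ∀ t ∈ Icc (-R) R, |deriv w t| ≤ κ)
    (hΩ : ∀ t ∈ Icc (-R) R, ∀ y, 0 < y → y < L * exp (-w t) → (A * t, y) ∈ Ω)
    (hg : SC1 g) (hg0 : tsupport g ⊆ Ioo 0 1) (hgn : g ≠ 0)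
    (hge : ∫ s, deriv g s ^ 2 ≤ (π ^ 2 + δ₁) * ∫ s, g s ^ 2)
    (hpot : ∀ t ∈ Icc (-R) R, (π ^ 2 + δ₁) * ((L ^ 2)⁻¹ * exp (2 * w t))
      ≤ π ^ 2 * (L ^ 2)⁻¹ + (A ^ 2)⁻¹ * (q t + δ₂))
    (F : Submodule ℝ (ℝ → ℝ)) (hF : Module.finrank ℝ F = j)
    (hFS : ∀ χ ∈ F, SC1 χ) (hFR : ∀ χ ∈ F, ∀ t, t ∉ Icc (-R) R → χ t = 0)
    (hFE : ∀ χ ∈ F, ∫ x, (deriv χ x ^ 2 + q x * χ x ^ 2) ≤ Λ * ∫ x, χ x ^ 2) :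
    Good2 Ω j (π ^ 2 * (L ^ 2)⁻¹ + (A ^ 2)⁻¹ *
      ((1 + κ) * Λ + (κ + κ ^ 2) * (2 * π ^ 2 + 3) + δ₂)) := by
  obtain ⟨s₀, hs₀⟩ := Function.ne_iff.1 hgn
  let T : (ℝ → ℝ) →ₗ[ℝ] (ℝ × ℝ → ℝ) :=
    { toFun := fun χ => itrf A L w (fun p => χ p.1 * g p.2)
      map_add' := by intro x y; funext p; simp only [itrf, Pi.add_apply]; ring
      map_smul' := by
        intro c y; funext p
        simp only [itrf, Pi.smul_apply, smul_eq_mul, RingHom.id_apply]; ring }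
  have hTtr : ∀ χ, trf A L w (T χ) = fun p => χ p.1 * g p.2 := by
    intro χ; exact trans_itrans (w := w) hA hL (fun p : ℝ × ℝ => χ p.1 * g p.2)
  have hTinj : Function.Injective T := by
    rw [injective_iff_map_eq_zero]
    intro χ hχ
    funext t
    have h1 := congrFun (hTtr χ) (t, s₀)
    rw [hχ] at h1
    simp only [trf, Pi.zero_apply, mul_zero] at h1
    rcases mul_eq_zero.1 h1.symm with h2 | h2
    · exact h2
    · exact absurd h2 hs₀
  refine ⟨F.map T, ?_, ?_, ?_⟩
  · rw [← hF]; exact (LinearEquiv.finrank_eq (Submodule.equivMapOfInjective T hTinj F)).symm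
  · rintro _ ⟨χ, hχ, rfl⟩
    have hu := prod_SC (hFS χ hχ) hg
    refine ⟨hu.itrf_sc hA hL hw, ?_⟩
    have hsub : tsupport (T χ) ⊆ (Phi A L hA hL w hw.continuous).symm ⁻¹'
        (Icc (-R) R ×ˢ tsupport g) := by
      apply closure_minimal
      · intro p hp
        have hp' : χ (p.1 / A) * g (p.2 * exp (w (p.1 / A)) / L) ≠ 0 := by
          intro h0; apply hp; change exp _ * _ = _; simp only [h0, mul_zero]
        constructor
        · by_contra h; exact hp' (by rw [hFR χ hχ (p.1 / A) h]; ring)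
        · exact subset_tsupport _ (right_ne_zero_of_mul hp')
      · exact (isClosed_Icc.prod (isClosed_tsupport g)).preimage (Homeomorph.continuous _)
    intro p hp
    obtain ⟨h1, h2⟩ := hsub hp
    have h1' : p.1 / A ∈ Icc (-R) R := h1
    have h2' : p.2 * exp (w (p.1 / A)) / L ∈ Ioo (0:ℝ) 1 := hg0 h2
    have := hΩ _ h1' p.2 (by
        have := h2'.1
        have h3 : 0 < p.2 * exp (w (p.1 / A)) := by
          rw [lt_div_iff₀ hL] at this; simpa using this
        exact pos_of_mul_pos_left h3 (exp_pos _).le)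
      (by
        have := h2'.2
        rw [div_lt_one hL] at this
        rw [exp_neg, ← div_eq_mul_inv, lt_div_iff₀ (exp_pos _)]
        exact this)
    rwa [mul_div_cancel₀ _ hA.ne'] at this
  · rintro _ ⟨χ, hχ, rfl⟩
    have hχS := hFS χ hχ
    have hu := prod_SC hχS hg
    have hψ : SC (T χ) := hu.itrf_sc hA hL hw
    set G := ∫ s, g s ^ 2 with hG
    set N := ∫ x, χ x ^ 2 with hN
    have hGp : 0 < G := integral_sq_pos hg.cont hg.2 hgn
    have hN0 : 0 ≤ N := integral_nonneg fun x => sq_nonneg _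
    have eN : ∫ p, (T χ) p ^ 2 = A * L * (N * G) := by
      rw [trans_norm hA hL hw hψ, hTtr]
      simp only [mul_pow]
      rw [hN, hG, ← integral_prod_mul]; rfl
    have dXu : ∀ p : ℝ × ℝ, dX (fun p : ℝ × ℝ => χ p.1 * g p.2) p = deriv χ p.1 * g p.2 := by
      intro p
      exact ((hχS.hasDerivAt p.1).mul_const (g p.2)).deriv
    have dYu : ∀ p : ℝ × ℝ, dY (fun p : ℝ × ℝ => χ p.1 * g p.2) p = χ p.1 * deriv g p.2 := by
      intro p
      exact ((hg.hasDerivAt p.2).const_mul (χ p.1)).deriv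
    -- one dimensional integrability
    have iχ : Integrable (fun x => χ x ^ 2) := integrable_sq_cs hχS.cont hχS.2
    have iχ' : Integrable (fun x => deriv χ x ^ 2) := integrable_sq_cs hχS.deriv.cont hχS.deriv.2
    have iqχ : Integrable (fun x => q x * χ x ^ 2) := integrable_mul_sq hq hχS.cont hχS.2
    have ig : Integrable (fun x => g x ^ 2) := integrable_sq_cs hg.cont hg.2
    have ig' : Integrable (fun x => deriv g x ^ 2) := integrable_sq_cs hg.deriv.cont hg.deriv.2
    have cg'' : Continuous (fun s => g s / 2 + s * deriv g s) := by
      have := hg.cont; have := hg.deriv.cont; fun_prop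
    have cs'' : HasCompactSupport (fun s => g s / 2 + s * deriv g s) := by
      have h1 : HasCompactSupport (fun s => (1/2 : ℝ) * g s) := hg.2.mul_left
      have h2 : HasCompactSupport (fun s => s * deriv g s) := hg.deriv.2.mul_left
      have h3 := h1.add h2
      have h4 : (fun s => g s / 2 + s * deriv g s) =
          (fun s => (1/2 : ℝ) * g s) + (fun s => s * deriv g s) := by
        funext s; simp only [Pi.add_apply]; ring
      rw [h4]; exact h3
    have ig'' : Integrable (fun s => (g s / 2 + s * deriv g s) ^ 2) := integrable_sq_cs cg'' cs''
    have hH : ∫ s, (g s / 2 + s * deriv g s) ^ 2 ≤ (2 * π ^ 2 + 3) * G := by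
      have h1 : ∫ s, (g s / 2 + s * deriv g s) ^ 2 ≤ ∫ s, ((1/2) * g s ^ 2 + 2 * deriv g s ^ 2) := by
        apply integral_mono ig'' ((ig.const_mul _).add (ig'.const_mul _))
        intro s
        change (g s / 2 + s * deriv g s) ^ 2 ≤ (1/2) * g s ^ 2 + 2 * deriv g s ^ 2
        by_cases hs : s ∈ Ioo (0:ℝ) 1
        · have : s ^ 2 ≤ 1 := by nlinarith [hs.1, hs.2]
          have h3 : s ^ 2 * deriv g s ^ 2 ≤ deriv g s ^ 2 := by nlinarith [sq_nonneg (deriv g s)]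
          nlinarith [sq_nonneg (g s / 2 - s * deriv g s)]
        · have z1 : g s = 0 := by
            by_contra h; exact hs (hg0 (subset_tsupport _ h))
          have z2 : deriv g s = 0 := by
            by_contra h; exact hs (hg0 (support_deriv_subset h))
          rw [z1, z2]; norm_num
      rw [integral_add (ig.const_mul _) (ig'.const_mul _), integral_const_mul,
        integral_const_mul] at h1
      nlinarith
    have hX : ∫ p, dX (T χ) p ^ 2 ≤ A * L * ((A ^ 2)⁻¹ * ((1 + κ) * ((∫ x, deriv χ x ^ 2) * G)
        + (κ + κ ^ 2) * (N * ((2 * π ^ 2 + 3) * G)))) := by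
      rw [trans_Xenergy hA hL hw hψ, hTtr]
      apply mul_le_mul_of_nonneg_left _ (by positivity)
      rw [integral_const_mul]
      apply mul_le_mul_of_nonneg_left _ (by positivity)
      have J1 : Integrable (fun p : ℝ × ℝ => deriv χ p.1 ^ 2 * g p.2 ^ 2) := iχ'.mul_prod ig
      have J2 : Integrable (fun p : ℝ × ℝ => χ p.1 ^ 2 * (g p.2 / 2 + p.2 * deriv g p.2) ^ 2) :=
        iχ.mul_prod ig''
      calc _ ≤ ∫ p : ℝ × ℝ, ((1 + κ) * (deriv χ p.1 ^ 2 * g p.2 ^ 2) + (κ + κ ^ 2) *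
            (χ p.1 ^ 2 * (g p.2 / 2 + p.2 * deriv g p.2) ^ 2)) := by
            apply integral_mono_of_nonneg (Eventually.of_forall fun p => sq_nonneg _)
              ((J1.const_mul _).add (J2.const_mul _))
            refine Eventually.of_forall fun p => ?_
            simp only [dXu, dYu]
            change _ ≤ (1 + κ) * (deriv χ p.1 ^ 2 * g p.2 ^ 2) + (κ + κ ^ 2) *
              (χ p.1 ^ 2 * (g p.2 / 2 + p.2 * deriv g p.2) ^ 2)
            by_cases ht : p.1 ∈ Icc (-R) R
            · have hk := hwκ _ ht
              have k1 : deriv w p.1 ^ 2 ≤ κ ^ 2 := sq_le_sq' (abs_le.1 hk).1 (abs_le.1 hk).2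
              set a := deriv χ p.1 * g p.2
              set b := χ p.1 * (g p.2 / 2 + p.2 * deriv g p.2)
              set d := deriv w p.1
              have e1 : (a + d * (χ p.1 * g p.2 / 2 + p.2 * (χ p.1 * deriv g p.2))) ^ 2
                = a ^ 2 + 2 * d * (a * b) + d ^ 2 * b ^ 2 := by simp only [b]; ring
              rw [e1]
              have e2 : 2 * d * (a * b) ≤ κ * (a ^ 2 + b ^ 2) := by
                have := abs_le.1 hk
                rcases le_total 0 (a * b) with h | h
                · nlinarith [sq_nonneg (a - b)]
                · nlinarith [sq_nonneg (a + b)]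
              have e3 : d ^ 2 * b ^ 2 ≤ κ ^ 2 * b ^ 2 := by nlinarith [sq_nonneg b]
              have e4 : deriv χ p.1 ^ 2 * g p.2 ^ 2 = a ^ 2 := by simp only [a]; ring
              have e5 : χ p.1 ^ 2 * (g p.2 / 2 + p.2 * deriv g p.2) ^ 2 = b ^ 2 := by
                simp only [b]; ring
              rw [e4, e5]; nlinarith
            · rw [hFR χ hχ _ ht]
              have : 0 ≤ κ * (deriv χ p.1 ^ 2 * g p.2 ^ 2) := by positivity
              nlinarith
        _ = (1 + κ) * ((∫ x, deriv χ x ^ 2) * G) + (κ + κ ^ 2) *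
            (N * ∫ s, (g s / 2 + s * deriv g s) ^ 2) := by
            rw [integral_add (J1.const_mul _) (J2.const_mul _), integral_const_mul,
              integral_const_mul, hN, hG, ← integral_prod_mul, ← integral_prod_mul]; rfl
        _ ≤ _ := by
            gcongr
    have hY : ∫ p, dY (T χ) p ^ 2 ≤ A * L * (G * (π ^ 2 * (L ^ 2)⁻¹ * N + (A ^ 2)⁻¹ *
        ((∫ x, q x * χ x ^ 2) + δ₂ * N))) := by
      rw [trans_Yenergy hA hL hw hψ, hTtr]
      apply mul_le_mul_of_nonneg_left _ (by positivity)
      have iw : Integrable (fun x => exp (2 * w x) * χ x ^ 2) :=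
        integrable_mul_sq (by have := hw.continuous; fun_prop) hχS.cont hχS.2
      have e1 : ∀ p : ℝ × ℝ, (L ^ 2)⁻¹ * (exp (2 * w p.1) * dY (fun p : ℝ × ℝ => χ p.1 * g p.2) p ^ 2)
          = (L ^ 2)⁻¹ * ((exp (2 * w p.1) * χ p.1 ^ 2) * deriv g p.2 ^ 2) := by
        intro p; rw [dYu]; ring
      simp only [e1]
      rw [integral_const_mul]
      have e2 : ∫ p : ℝ × ℝ, (exp (2 * w p.1) * χ p.1 ^ 2) * deriv g p.2 ^ 2
        = (∫ x, exp (2 * w x) * χ x ^ 2) * ∫ s, deriv g s ^ 2 := by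
        rw [← integral_prod_mul]; rfl
      rw [e2]
      have h0 : 0 ≤ ∫ x, exp (2 * w x) * χ x ^ 2 := integral_nonneg fun x => by positivity
      calc _ ≤ (L ^ 2)⁻¹ * ((∫ x, exp (2 * w x) * χ x ^ 2) * ((π ^ 2 + δ₁) * G)) := by gcongr
        _ = G * ∫ x, ((π ^ 2 + δ₁) * ((L ^ 2)⁻¹ * exp (2 * w x))) * χ x ^ 2 := by
            have : ∀ x, ((π ^ 2 + δ₁) * ((L ^ 2)⁻¹ * exp (2 * w x))) * χ x ^ 2
              = ((π ^ 2 + δ₁) * (L ^ 2)⁻¹) * (exp (2 * w x) * χ x ^ 2) := fun x => by ring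
            simp only [this]
            rw [integral_const_mul]; ring
        _ ≤ G * ∫ x, (π ^ 2 * (L ^ 2)⁻¹ * χ x ^ 2 + (A ^ 2)⁻¹ * (q x * χ x ^ 2 + δ₂ * χ x ^ 2)) := by
            apply mul_le_mul_of_nonneg_left _ hGp.le
            apply integral_mono
            · apply integrable_mul_sq _ hχS.cont hχS.2
              have := hw.continuous; fun_prop
            · exact (iχ.const_mul _).add ((iqχ.add (iχ.const_mul _)).const_mul _)
            · intro x
              simp only
              by_cases hx : x ∈ Icc (-R) R
              · have := mul_le_mul_of_nonneg_right (hpot x hx) (sq_nonneg (χ x))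
                linarith
              · rw [hFR χ hχ _ hx]; norm_num
        _ = _ := by
            have i3 : Integrable (fun x => (A ^ 2)⁻¹ * (q x * χ x ^ 2 + δ₂ * χ x ^ 2)) :=
              (iqχ.add (iχ.const_mul _)).const_mul _
            rw [integral_add (iχ.const_mul _) i3,
              integral_const_mul, integral_const_mul, integral_add iqχ (iχ.const_mul _),
              integral_const_mul]
    have hE := hFE χ hχ
    rw [integral_add iχ' iqχ] at hE
    rw [gradSq_eq, integral_add (integrable_sq_cs hψ.dX.cont hψ.dX.2)
      (integrable_sq_cs hψ.dY.cont hψ.dY.2), eN]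
    refine (add_le_add hX hY).trans ?_
    have hq' : 0 ≤ ∫ x, q x * χ x ^ 2 := integral_nonneg fun x => by have := hq0 x; positivity
    set X' := ∫ x, deriv χ x ^ 2
    set Q' := ∫ x, q x * χ x ^ 2
    have h1 : (1 + κ) * X' + Q' ≤ (1 + κ) * (Λ * N) := by nlinarith
    have h2 : 0 ≤ A * L * G * (A ^ 2)⁻¹ := by positivity
    have h3 := mul_le_mul_of_nonneg_left h1 h2
    linear_combination h3

lemma exists_phi {η : ℝ} (hη : 0 < η) : ∃ φ : ℝ → ℝ, ContDiff ℝ (⊤ : ℕ∞) φ ∧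
    (∀ s, s ≤ η → φ s = 0) ∧ (∀ s, |deriv φ s| ≤ 1) ∧ (∀ s, 0 ≤ s → 0 ≤ φ s) ∧
    (∀ s, 0 ≤ s → s - 2 * η ≤ φ s) := by
  let S : ℝ → ℝ := fun x => Real.smoothTransition ((x - η) / η)
  have hS : ContDiff ℝ (⊤ : ℕ∞) S :=
    Real.smoothTransition.contDiff.comp ((contDiff_id.sub contDiff_const).div_const _)
  have hS0 : ∀ x, 0 ≤ S x := fun x => Real.smoothTransition.nonneg _
  have hS1 : ∀ x, S x ≤ 1 := fun x => Real.smoothTransition.le_one _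
  have hSz : ∀ x, x ≤ η → S x = 0 := fun x hx =>
    Real.smoothTransition.zero_of_nonpos (div_nonpos_of_nonpos_of_nonneg (by linarith) hη.le)
  have hSo : ∀ x, 2 * η ≤ x → S x = 1 := fun x hx =>
    Real.smoothTransition.one_of_one_le (by rw [le_div_iff₀ hη]; linarith)
  have hi : ∀ u v, IntervalIntegrable S volume u v := fun u v => hS.continuous.intervalIntegrable u v
  have hd : ∀ s, HasDerivAt (fun s => ∫ x in (0:ℝ)..s, S x) (S s) s := fun s =>
    intervalIntegral.integral_hasDerivAt_right (hi _ _)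
      (hS.continuous.stronglyMeasurableAtFilter _ _) hS.continuous.continuousAt
  have hder : deriv (fun s => ∫ x in (0:ℝ)..s, S x) = S := funext fun s => (hd s).deriv
  refine ⟨fun s => ∫ x in (0:ℝ)..s, S x, ?_, ?_, ?_, ?_, ?_⟩
  · rw [contDiff_infty_iff_deriv]
    refine ⟨fun s => (hd s).differentiableAt, ?_⟩
    rw [hder]; exact hS
  · intro s hs
    have : ∫ x in (0:ℝ)..s, S x = ∫ x in (0:ℝ)..s, (0:ℝ) := by
      apply intervalIntegral.integral_congr
      intro x hx
      apply hSz
      rcases le_total 0 s with h | h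
      · rw [uIcc_of_le h] at hx; linarith [hx.2]
      · rw [uIcc_of_ge h] at hx; linarith [hx.2]
    simp only [this]; simp
  · intro s; rw [hder, abs_of_nonneg (hS0 s)]; exact hS1 s
  · intro s hs; exact intervalIntegral.integral_nonneg hs fun x _ => hS0 x
  · intro s hs
    rcases le_total s (2 * η) with h | h
    · have := intervalIntegral.integral_nonneg (μ := volume) hs fun x _ => hS0 x
      simp only; linarith
    · simp only
      rw [← intervalIntegral.integral_add_adjacent_intervals (hi 0 (2 * η)) (hi _ s)]
      have h1 : 0 ≤ ∫ x in (0:ℝ)..(2*η), S x :=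
        intervalIntegral.integral_nonneg (by linarith) fun x _ => hS0 x
      have h2 : ∫ x in (2*η)..s, S x = ∫ x in (2*η)..s, (1:ℝ) := by
        apply intervalIntegral.integral_congr
        intro x hx
        rw [uIcc_of_le h] at hx
        exact hSo x hx.1
      rw [h2]; simp; linarith

lemma int_cos_sq_pi : ∫ t in Icc (0:ℝ) 1, (π * cos (π * t)) ^ 2 = π ^ 2 / 2 := by
  rw [integral_Icc_eq_integral_Ioc, ← intervalIntegral.integral_of_le zero_le_one]
  simp only [mul_pow]
  rw [intervalIntegral.integral_const_mul,
    intervalIntegral.integral_comp_mul_left (fun x => cos x ^ 2) pi_ne_zero, integral_cos_sq]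
  simp; field_simp

lemma int_sin_sq_pi : ∫ t in Icc (0:ℝ) 1, (sin (π * t)) ^ 2 = 1 / 2 := by
  rw [integral_Icc_eq_integral_Ioc, ← intervalIntegral.integral_of_le zero_le_one]
  rw [intervalIntegral.integral_comp_mul_left (fun x => sin x ^ 2) pi_ne_zero, integral_sin_sq]
  simp; field_simp

lemma exists_g {δ : ℝ} (hδ : 0 < δ) : ∃ g : ℝ → ℝ, SC1 g ∧ tsupport g ⊆ Ioo 0 1 ∧ g ≠ 0 ∧
    ∫ s, deriv g s ^ 2 ≤ (π ^ 2 + δ) * ∫ s, g s ^ 2 := by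
  have hπ := pi_pos
  set η : ℝ := δ / (8 * (π ^ 2 + δ)) with hηd
  have hη : 0 < η := by positivity
  have hη2 : η * (8 * (π ^ 2 + δ)) = δ := by rw [hηd]; field_simp
  have hη3 : η < 1 / 8 := by
    by_contra h; push Not at h; nlinarith [sq_nonneg π, sq_pos_of_pos hπ]
  obtain ⟨φ, hφ, hφ0, hφ1, hφn, hφs⟩ := exists_phi hη
  let s : ℝ → ℝ := fun t => sin (π * max 0 (min t 1))
  have hsc : Continuous s := by fun_prop
  have hs01 : ∀ t ∈ Icc (0:ℝ) 1, s t = sin (π * t) := by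
    intro t ht; simp only [s]; rw [min_eq_left ht.2, max_eq_right ht.1]
  have hsout : ∀ t, t ∉ Ioo (0:ℝ) 1 → s t = 0 := by
    intro t ht
    simp only [s]
    rcases le_or_gt t 0 with h | h
    · rw [min_eq_left (by linarith), max_eq_left h]; simp
    · have : 1 ≤ t := by by_contra h'; exact ht ⟨h, by linarith⟩
      rw [min_eq_right this]; simp
  let g : ℝ → ℝ := fun t => φ (s t)
  have hgout : ∀ t, t ∉ Ioo (0:ℝ) 1 → g t = 0 := by
    intro t ht; simp only [g]; rw [hsout t ht]; exact hφ0 0 hη.le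
  have hloc0 : ∀ t, s t < η → g =ᶠ[nhds t] fun _ => 0 := by
    intro t ht
    filter_upwards [hsc.continuousAt.eventually (gt_mem_nhds ht)] with x hx
    exact hφ0 _ hx.le
  have hin : ∀ t, η ≤ s t → t ∈ Ioo (0:ℝ) 1 := by
    intro t ht; by_contra h; rw [hsout t h] at ht; linarith
  have hloc1 : ∀ t, t ∈ Ioo (0:ℝ) 1 → g =ᶠ[nhds t] fun t => φ (sin (π * t)) := by
    intro t ht
    filter_upwards [Ioo_mem_nhds ht.1 ht.2] with x hx
    simp only [g]; rw [hs01 x (Ioo_subset_Icc_self hx)]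
  have hgs : ContDiff ℝ (⊤ : ℕ∞) g := by
    rw [contDiff_iff_contDiffAt]
    intro t
    rcases lt_or_ge (s t) η with h | h
    · exact contDiffAt_const.congr_of_eventuallyEq (hloc0 t h)
    · refine ContDiffAt.congr_of_eventuallyEq ?_ (hloc1 t (hin t h))
      exact (hφ.comp (Real.contDiff_sin.comp (contDiff_const.mul contDiff_id))).contDiffAt
  have hsup : tsupport g ⊆ {t | η ≤ s t} := by
    apply closure_minimal
    · intro t ht
      by_contra h
      exact ht (hφ0 _ (not_le.1 h).le)
    · exact isClosed_le continuous_const hsc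
  have hgc : HasCompactSupport g := by
    apply HasCompactSupport.intro (isCompact_Icc (a := (0:ℝ)) (b := 1))
    intro t ht
    exact hgout t fun h => ht (Ioo_subset_Icc_self h)
  have hg : SC1 g := ⟨hgs, hgc⟩
  have ind : ∀ (f : ℝ → ℝ), (∀ t, t ∉ Icc (0:ℝ) 1 → f t = 0) → ∫ t, f t = ∫ t in Icc (0:ℝ) 1, f t := by
    intro f hf
    rw [setIntegral_eq_integral_of_forall_compl_eq_zero hf]
  have hE : ∫ t, deriv g t ^ 2 ≤ π ^ 2 / 2 := by
    rw [ind, ← int_cos_sq_pi]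
    · apply setIntegral_mono_on
      · exact (hg.deriv.cont.pow 2).integrableOn_Icc
      · apply Continuous.integrableOn_Icc; fun_prop
      · exact measurableSet_Icc
      · intro t ht
        by_cases h : t ∈ Ioo (0:ℝ) 1
        · rw [(hloc1 t h).deriv_eq]
          have h1 : HasDerivAt (fun t => φ (sin (π * t))) (deriv φ (sin (π * t)) * (cos (π * t) * (π * 1))) t :=
            HasDerivAt.comp t ((hφ.differentiable (by simp)) _).hasDerivAt
              (((hasDerivAt_id t).const_mul π).sin)
          rw [h1.deriv]
          have h2 : deriv φ (sin (π * t)) ^ 2 ≤ 1 := by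
            rw [sq_le_one_iff_abs_le_one]; exact hφ1 _
          calc _ = deriv φ (sin (π * t)) ^ 2 * (π * cos (π * t)) ^ 2 := by ring
            _ ≤ 1 * _ := by gcongr
            _ = _ := one_mul _
        · have : s t < η := by rw [hsout t h]; exact hη
          rw [(hloc0 t this).deriv_eq]; simp; positivity
    · intro t ht
      have : s t < η := by rw [hsout t (fun h => ht (Ioo_subset_Icc_self h))]; exact hη
      rw [(hloc0 t this).deriv_eq]; simp
  have hN : 1 / 2 - 4 * η ≤ ∫ t, g t ^ 2 := by
    rw [ind]
    · have : ∫ t in Icc (0:ℝ) 1, (sin (π * t) ^ 2 - 4 * η) = 1 / 2 - 4 * η := by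
        rw [integral_sub, int_sin_sq_pi]
        · simp
        · apply Continuous.integrableOn_Icc; fun_prop
        · apply Continuous.integrableOn_Icc; fun_prop
      rw [← this]
      apply setIntegral_mono_on
      · apply Continuous.integrableOn_Icc; fun_prop
      · exact (hg.cont.pow 2).integrableOn_Icc
      · exact measurableSet_Icc
      · intro t ht
        simp only [g]
        rw [hs01 t ht]
        have h0 : 0 ≤ sin (π * t) := sin_nonneg_of_nonneg_of_le_pi
          (mul_nonneg hπ.le ht.1) (by nlinarith [ht.2])
        have h1 := sin_le_one (π * t)
        have h2 := hφs _ h0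
        have h3 := hφn _ h0
        set x := sin (π * t)
        rcases le_total x (2 * η) with h | h
        · nlinarith [sq_nonneg (φ x)]
        · nlinarith
    · intro t ht
      rw [hgout t (fun h => ht (Ioo_subset_Icc_self h))]; simp
  refine ⟨g, hg, fun t ht => hin t (hsup ht), ?_, ?_⟩
  · intro h0
    rw [h0] at hN
    simp at hN; linarith
  · refine hE.trans ?_
    have : (π ^ 2 + δ) * (1 / 2 - 4 * η) ≤ (π ^ 2 + δ) * ∫ t, g t ^ 2 := by gcongr
    nlinarith

lemma Good2.mono {Ω : Set (ℝ × ℝ)} {j : ℕ} {A B : ℝ} (h : Good2 Ω j A) (hAB : A ≤ B) :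
    Good2 Ω j B := by
  obtain ⟨F, h1, h2, h3⟩ := h
  refine ⟨F, h1, h2, fun ψ hψ => (h3 ψ hψ).trans ?_⟩
  exact mul_le_mul_of_nonneg_right hAB (integral_nonneg fun _ => sq_nonneg _)

lemma Good1.mono {q : ℝ → ℝ} {j : ℕ} {A B : ℝ} (h : Good1 q j A) (hAB : A ≤ B) :
    Good1 q j B := by
  obtain ⟨F, h1, h2, h3⟩ := h
  refine ⟨F, h1, h2, fun ψ hψ => (h3 ψ hψ).trans ?_⟩
  exact mul_le_mul_of_nonneg_right hAB (integral_nonneg fun _ => sq_nonneg _)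

lemma poly_approx {f : ℝ → ℝ} (hf : Continuous f) (R : ℝ) {δ : ℝ} (hδ : 0 < δ) :
    ∃ P : ℝ → ℝ, ContDiff ℝ (⊤ : ℕ∞) P ∧ (∀ t ∈ Icc (-R) R, |P t - f t| ≤ δ) ∧
      ∃ B, 0 < B ∧ ∀ t ∈ Icc (-R) R, |P t| ≤ B ∧ |deriv P t| ≤ B := by
  obtain ⟨p, hp⟩ := exists_polynomial_near_of_continuousOn (-R) R f hf.continuousOn δ hδ
  have hc : ContDiff ℝ (⊤ : ℕ∞) (fun t => p.eval t) := p.contDiff_aeval (𝕜 := ℝ) _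
  have hc' : Continuous (deriv (fun t => p.eval t)) := hc.continuous_deriv (by simp)
  refine ⟨fun t => p.eval t, hc, fun t ht => (hp t ht).le, ?_⟩
  obtain ⟨B1, hB1⟩ := (isCompact_Icc (a := -R) (b := R)).exists_bound_of_continuousOn
    hc.continuous.continuousOn
  obtain ⟨B2, hB2⟩ := (isCompact_Icc (a := -R) (b := R)).exists_bound_of_continuousOn
    hc'.continuousOn
  refine ⟨max (max B1 B2) 1, by positivity, fun t ht => ⟨?_, ?_⟩⟩
  · exact (hB1 t ht).trans ((le_max_left _ _).trans (le_max_left _ _))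
  · exact (hB2 t ht).trans ((le_max_right _ _).trans (le_max_left _ _))

lemma supp_bound {F : Submodule ℝ (ℝ → ℝ)} {j : ℕ} (hj : 1 ≤ j) (hF : Module.finrank ℝ F = j)
    (hFS : ∀ χ ∈ F, SC1 χ) : ∃ R, 0 < R ∧ ∀ χ ∈ F, ∀ t, t ∉ Icc (-R) R → χ t = 0 := by
  have : Module.Finite ℝ F := Module.finite_of_finrank_pos (by omega)
  let b := Module.finBasis ℝ F
  have hK : IsCompact (⋃ i, tsupport (b i : ℝ → ℝ)) :=
    isCompact_iUnion fun i => (hFS _ (b i).2).2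
  obtain ⟨R, hR⟩ := hK.isBounded.exists_norm_le
  refine ⟨max R 1, by positivity, fun χ hχ t ht => ?_⟩
  have h0 : ∀ i, (b i : ℝ → ℝ) t = 0 := by
    intro i
    by_contra h
    have := hR t (mem_iUnion.2 ⟨i, subset_tsupport _ h⟩)
    apply ht
    rw [Real.norm_eq_abs] at this
    exact abs_le.1 (this.trans (le_max_left _ _))
  have h1 := b.sum_repr ⟨χ, hχ⟩
  have h2 := congrArg (fun x : F => (x : ℝ → ℝ) t) h1
  simp only at h2
  rw [← h2, Submodule.coe_sum, Finset.sum_apply]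
  apply Finset.sum_eq_zero
  intro i _
  rw [Submodule.coe_smul, Pi.smul_apply, h0, smul_zero]

lemma scal_eq {m α ε : ℝ} (hm : 1 ≤ m) (hα : α = 2 / (m + 2)) (hε : 0 < ε) :
    (ε ^ α) ^ m = ε ^ (α * m) ∧ (ε ^ α) ^ 2 * ε ^ (α * m) = ε ^ 2 := by
  refine ⟨(rpow_mul hε.le _ _).symm, ?_⟩
  rw [← rpow_natCast (ε ^ α) 2, ← rpow_mul hε.le, ← rpow_add hε, ← rpow_natCast ε 2]
  congr 1
  rw [hα]; push_cast; field_simp; ring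

lemma scal_ev {m α : ℝ} (hm : 1 ≤ m) (hα : α = 2 / (m + 2)) {p : ℝ × ℝ → Prop}
    (hp : ∀ᶠ z in nhds ((0:ℝ), (0:ℝ)), p z) :
    ∀ᶠ ε in nhdsWithin (0:ℝ) (Ioi 0), p (ε ^ α, ε ^ (α * m)) := by
  have hα0 : 0 < α := by rw [hα]; positivity
  have h : ∀ β : ℝ, 0 < β → Tendsto (fun ε : ℝ => ε ^ β) (nhdsWithin (0:ℝ) (Ioi 0)) (nhds 0) := by
    intro β hβ
    have := (continuousAt_rpow_const 0 β (Or.inr hβ.le)).tendsto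
    rw [zero_rpow hβ.ne'] at this
    exact this.mono_left nhdsWithin_le_nhds
  exact ((h α hα0).prodMk_nhds (h (α * m) (by positivity))).eventually hp

lemma ev_lt {f : ℝ × ℝ → ℝ} (hf : Continuous f) {c : ℝ} (h : f (0, 0) < c) :
    ∀ᶠ z in nhds ((0:ℝ), (0:ℝ)), f z < c := hf.continuousAt.eventually (gt_mem_nhds h)

/-- the domain -/
def dom (a b : ℝ) (h : ℝ → ℝ) (ε : ℝ) : Set (ℝ × ℝ) :=
  {p : ℝ × ℝ | p.1 ∈ Icc (-a) b ∧ 0 < p.2 ∧ p.2 < ε * h p.1}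

lemma exp_le_quad {x : ℝ} (hx : |x| ≤ 1) : exp x ≤ 1 + x + x ^ 2 := by
  have := Real.abs_exp_sub_one_sub_id_le hx
  have := (abs_le.1 this).2
  linarith

set_option maxHeartbeats 1000000 in
lemma upper {a b : ℝ} (ha : 0 < a) (hb : 0 < b) {h V q : ℝ → ℝ} {m α K η M Λ : ℝ} {j : ℕ} (hj : 1 ≤ j)
    (hm : 1 ≤ m) (hα : α = 2 / (m + 2)) (hM : 0 < M) (hη : 0 < η) (hK : 0 < K)
    (hV : Continuous V) (hV0 : ∀ t, 0 ≤ V t) (hVh : ∀ A t, 0 < A → V (A * t) = A ^ m * V t)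
    (hexp : ∀ x, |x| ≤ η → |h x - (M - V x)| ≤ K * |x| ^ (m + 1))
    (hq : q = fun t => 2 * π ^ 2 * V t / M ^ 3) (hG : Good1 q j Λ) {δ : ℝ} (hδ : 0 < δ) :
    ∀ᶠ ε in nhdsWithin (0:ℝ) (Ioi 0), Good2 (dom a b h ε) j
      (π ^ 2 * ((ε * M) ^ 2)⁻¹ + ((ε ^ α) ^ 2)⁻¹ * (Λ + δ)) := by
  have hπ := pi_pos
  obtain ⟨F, hF, hFS, hFE⟩ := hG
  obtain ⟨R, hR, hFR⟩ := supp_bound hj hF hFS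
  have hqc : Continuous q := by rw [hq]; fun_prop
  have hq0 : ∀ t, 0 ≤ q t := by intro t; rw [hq]; have := hV0 t; positivity
  set δ' : ℝ := δ * M ^ 3 / (12 * π ^ 2) with hδ'
  have hδ'p : 0 < δ' := by positivity
  obtain ⟨P, hP, hPa, B, hB, hPB⟩ := poly_approx (f := fun t => V t + δ') (by fun_prop) R
    (δ := δ' / 2) (by positivity)
  set D : ℝ := |Λ| + 2 * π ^ 2 + 3 with hD
  have e1 := scal_ev hm hα (ev_lt (f := fun z => z.1 * R) (c := min a b) (by fun_prop)
    (by simp; exact ⟨ha, hb⟩))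
  have e2 := scal_ev hm hα (ev_lt (f := fun z => z.1 * R) (c := η) (by fun_prop) (by simpa using hη))
  have e3 := scal_ev hm hα (ev_lt (f := fun z => z.1 * (K * R ^ (m + 1)) + z.2 * (B ^ 2 / M))
    (c := δ' / 2) (by fun_prop) (by simpa using hδ'p))
  have e4 := scal_ev hm hα (ev_lt (f := fun z => z.2 * (2 * (B / M)))
    (c := 1) (by fun_prop) (by simp))
  have e5 := scal_ev hm hα (ev_lt (f := fun z => z.2 * (4 * π ^ 2 * B ^ 2 / M ^ 4 + 3 / M ^ 2))
    (c := δ / 4) (by fun_prop) (by simpa using hδ))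
  have e6 := scal_ev hm hα (ev_lt (f := fun z => (z.2 * (B / M) + (z.2 * (B / M)) ^ 2) * D)
    (c := δ / 2) (by fun_prop) (by simpa using hδ))
  have e7 := scal_ev hm hα (ev_lt (f := fun z => z.2) (c := 1) (by fun_prop) (by simp))
  filter_upwards [e1, e2, e3, e4, e5, e6, e7, self_mem_nhdsWithin] with ε e1 e2 e3 e4 e5 e6 e7 hε
  have hε : 0 < ε := hε
  obtain ⟨s1, s2⟩ := scal_eq hm hα hε
  have hA : 0 < ε ^ α := rpow_pos_of_pos hε _
  have hy : 0 < ε ^ (α * m) := rpow_pos_of_pos hε _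
  set A := ε ^ α
  set y := ε ^ (α * m)
  obtain ⟨g, hg, hg0, hgn, hge⟩ := exists_g (δ := y ^ 2) (by positivity)
  let w : ℝ → ℝ := fun t => y / M * P t
  have hw : ContDiff ℝ (⊤ : ℕ∞) w := contDiff_const.mul hP
  have hwb : ∀ t ∈ Icc (-R) R, |w t| ≤ y * (B / M) := by
    intro t ht
    simp only [w]
    rw [abs_mul, abs_of_pos (by positivity)]
    calc y / M * |P t| ≤ y / M * B := by gcongr; exact (hPB t ht).1
      _ = _ := by ring
  have hw1 : ∀ t ∈ Icc (-R) R, |2 * w t| ≤ 1 := by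
    intro t ht; rw [abs_mul]; have := hwb t ht; simp; nlinarith
  have hwsq : ∀ t ∈ Icc (-R) R, w t ^ 2 ≤ (y * (B / M)) ^ 2 := fun t ht =>
    sq_le_sq' (abs_le.1 (hwb t ht)).1 (abs_le.1 (hwb t ht)).2
  have key := upper_core (Ω := dom a b h ε) (q := q) (w := w) (g := g) (A := A) (L := ε * M)
    (R := R) (Λ := Λ) (κ := y * (B / M)) (δ₁ := y ^ 2) (δ₂ := δ / 2) (j := j) hA (by positivity) hw hqc
    hq0 (by positivity) (by nlinarith) ?_ ?_ hg hg0 hgn hge ?_ F hF hFS hFR hFE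
  · refine key.mono ?_
    refine add_le_add le_rfl (mul_le_mul_of_nonneg_left ?_ (by positivity))
    have : Λ ≤ |Λ| := le_abs_self _
    have h1 : y * (B / M) * Λ ≤ (y * (B / M) + (y * (B / M)) ^ 2) * |Λ| := by
      have h2 : 0 ≤ (y * (B / M)) ^ 2 * |Λ| := by positivity
      have h3 : y * (B / M) * Λ ≤ y * (B / M) * |Λ| := by gcongr
      linarith
    have h2 : (y * (B / M) + (y * (B / M)) ^ 2) * D =
      (y * (B / M) + (y * (B / M)) ^ 2) * |Λ| + (y * (B / M) + (y * (B / M)) ^ 2) * (2 * π ^ 2 + 3) := by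
      rw [hD]; ring
    linarith
  · intro t ht
    have : deriv w t = y / M * deriv P t := deriv_const_mul _ (hP.differentiable (by simp) t)
    rw [this, abs_mul, abs_of_pos (by positivity)]
    calc y / M * |deriv P t| ≤ y / M * B := by gcongr; exact (hPB t ht).2
      _ = _ := by ring
  · intro t ht z hz hz2
    have hAt : |A * t| ≤ A * R := by
      rw [abs_mul, abs_of_pos hA]; gcongr; exact abs_le.2 ht
    have hAt' := abs_le.1 hAt
    have hm1 := min_le_left a b
    have hm2 := min_le_right a b
    refine ⟨⟨by linarith, by linarith⟩, hz, hz2.trans_le ?_⟩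
    rw [mul_assoc]
    apply mul_le_mul_of_nonneg_left _ hε.le
    have h1 := (abs_le.1 (hexp (A * t) (by linarith))).1
    have h2 : |A * t| ^ (m + 1) ≤ (A * R) ^ (m + 1) := by gcongr
    have h3 : (A * R) ^ (m + 1) = y * (A * R ^ (m + 1)) := by
      rw [mul_rpow hA.le hR.le, rpow_add hA, s1, rpow_one]; ring
    rw [hVh A t hA, s1] at h1
    have h4 : exp (-w t) ≤ 1 + -w t + (-w t) ^ 2 := by
      apply exp_le_quad
      rw [abs_neg]; have := hw1 t ht; rw [abs_mul] at this; simp at this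
      linarith [abs_nonneg (w t)]
    have h5 : M * exp (-w t) ≤ M * (1 + -w t + (-w t) ^ 2) := by gcongr
    have h6 : M * w t = y * P t := by simp only [w]; field_simp
    have h7 : M * (-w t) ^ 2 ≤ y * (y * (B ^ 2 / M)) := by
      calc M * (-w t) ^ 2 ≤ M * (y * (B / M)) ^ 2 := by
            rw [neg_sq]; exact mul_le_mul_of_nonneg_left (hwsq t ht) hM.le
        _ = _ := by field_simp
    have h8 := (abs_le.1 (hPa t ht)).1
    have h9 : K * |A * t| ^ (m + 1) ≤ y * (A * (K * R ^ (m + 1))) := by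
      calc _ ≤ K * (A * R) ^ (m + 1) := by gcongr
        _ = _ := by rw [h3]; ring
    have h10 : y * (A * (K * R ^ (m + 1)) + y * (B ^ 2 / M)) ≤ y * (δ' / 2) := by gcongr
    have h11 : y * (V t + δ' / 2) ≤ y * P t := by gcongr; linarith
    linarith
  · intro t ht
    have hy' : (A ^ 2)⁻¹ = y * (ε ^ 2)⁻¹ := by
      rw [← s2]; field_simp
    have hL' : ((ε * M) ^ 2)⁻¹ = (M ^ 2)⁻¹ * (ε ^ 2)⁻¹ := by field_simp
    rw [hy', hL']
    suffices hh : (π ^ 2 + y ^ 2) * ((M ^ 2)⁻¹ * exp (2 * w t)) ≤ π ^ 2 * (M ^ 2)⁻¹ +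
        y * (q t + δ / 2) by
      have := mul_le_mul_of_nonneg_right hh (by positivity : 0 ≤ (ε ^ 2)⁻¹)
      linarith
    have h1 := exp_le_quad (hw1 t ht)
    have h2 : exp (2 * w t) ≤ 3 := by
      have := abs_le.1 (hw1 t ht); nlinarith
    have h3 := hwsq t ht
    have h4 : π ^ 2 * (M ^ 2)⁻¹ * exp (2 * w t) ≤ π ^ 2 * (M ^ 2)⁻¹ * (1 + 2 * w t + (2 * w t) ^ 2) := by
      gcongr
    have h5 : π ^ 2 * (M ^ 2)⁻¹ * (2 * w t) ≤ y * (q t + δ / 4) := by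
      have : π ^ 2 * (M ^ 2)⁻¹ * (2 * w t) = y * (2 * π ^ 2 / M ^ 3 * P t) := by
        simp only [w]; field_simp
      rw [this]
      apply mul_le_mul_of_nonneg_left _ hy.le
      have h8 := (abs_le.1 (hPa t ht)).2
      calc 2 * π ^ 2 / M ^ 3 * P t ≤ 2 * π ^ 2 / M ^ 3 * (V t + 3 * δ' / 2) := by gcongr; linarith
        _ = _ := by rw [hq, hδ']; field_simp; ring
    have h6 : π ^ 2 * (M ^ 2)⁻¹ * (2 * w t) ^ 2 ≤ y * (y * (4 * π ^ 2 * B ^ 2 / M ^ 4)) := by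
      calc _ = π ^ 2 * (M ^ 2)⁻¹ * 4 * (w t) ^ 2 := by ring
        _ ≤ π ^ 2 * (M ^ 2)⁻¹ * 4 * (y * (B / M)) ^ 2 := by gcongr
        _ = _ := by field_simp
    have h7 : y ^ 2 * ((M ^ 2)⁻¹ * exp (2 * w t)) ≤ y * (y * (3 / M ^ 2)) := by
      calc _ ≤ y ^ 2 * ((M ^ 2)⁻¹ * 3) := by gcongr
        _ = _ := by field_simp
    have h8 : y * (y * (4 * π ^ 2 * B ^ 2 / M ^ 4 + 3 / M ^ 2)) ≤ y * (δ / 4) := by gcongr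
    linarith

lemma finrank_map_inj {X Y : Type*} [AddCommGroup X] [Module ℝ X] [AddCommGroup Y] [Module ℝ Y]
    (T : X →ₗ[ℝ] Y) (F : Submodule ℝ X) (h : ∀ x ∈ F, T x = 0 → x = 0) :
    Module.finrank ℝ (F.map T) = Module.finrank ℝ F := by
  have h1 : F.map T = LinearMap.range (T.domRestrict F) := by
    rw [LinearMap.range_domRestrict]
  rw [h1]
  apply LinearMap.finrank_range_of_inj
  rw [injective_iff_map_eq_zero]
  intro x hx
  exact Subtype.ext (h x x.2 hx)

lemma fub_nonneg {ρ : ℝ → ℝ} (hρ : Continuous ρ) (hρ0 : ∀ x, 0 ≤ ρ x) {f : ℝ × ℝ → ℝ}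
    (hf : Continuous f) (hc : HasCompactSupport f) (h : ∀ x, 0 ≤ ∫ y, f (x, y)) :
    0 ≤ ∫ p : ℝ × ℝ, ρ p.1 * f p := by
  have hi : Integrable (fun p : ℝ × ℝ => ρ p.1 * f p) (volume.prod volume) := by
    have h1 : Continuous (fun p : ℝ × ℝ => ρ p.1 * f p) := by fun_prop
    exact h1.integrable_of_hasCompactSupport hc.mul_left
  have : ∫ p : ℝ × ℝ, ρ p.1 * f p = ∫ x, ∫ y, ρ x * f (x, y) := integral_prod _ hi
  rw [this]
  apply integral_nonneg
  intro x
  simp only [Pi.zero_apply]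
  rw [integral_const_mul]
  exact mul_nonneg (hρ0 x) (h x)

lemma fub_eq {f : ℝ × ℝ → ℝ} (hf : Continuous f) (hc : HasCompactSupport f) :
    ∫ p : ℝ × ℝ, f p = ∫ x, ∫ y, f (x, y) := 
  integral_prod _ (hf.integrable_of_hasCompactSupport (μ := volume.prod volume) hc)

lemma slice_cs {f : ℝ × ℝ → ℝ} (hc : HasCompactSupport f) (x : ℝ) :
    HasCompactSupport (fun y => f (x, y)) := by
  have h2 : HasCompactSupport f := hc
  apply HasCompactSupport.intro (h2.isCompact.image continuous_snd)
  intro y hy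
  by_contra h
  exact hy ⟨(x, y), subset_tsupport _ h, rfl⟩

lemma slice_contDiff {f : ℝ × ℝ → ℝ} (hf : ContDiff ℝ (⊤ : ℕ∞) f) (x : ℝ) :
    ContDiff ℝ (⊤ : ℕ∞) (fun y => f (x, y)) := hf.comp (contDiff_const.prodMk contDiff_id)

lemma slice_cint {f : ℝ × ℝ → ℝ} (hf : Continuous f) (hc : HasCompactSupport f) (x : ℝ) :
    Integrable (fun y => f (x, y)) := by
  have h1 : Continuous (fun y => f (x, y)) := by fun_prop
  exact h1.integrable_of_hasCompactSupport (slice_cs hc x)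

/-- sine coefficient -/
noncomputable def sco (u : ℝ × ℝ → ℝ) (t : ℝ) : ℝ := ∫ s, u (t, s) * sin (π * s)

lemma sco_deriv {u : ℝ × ℝ → ℝ} (hu : SC u) (t : ℝ) : HasDerivAt (sco u) (sco (dX u) t) t := by
  obtain ⟨C, hC⟩ := hu.dX.2.exists_bound_of_continuous hu.dX.cont
  obtain ⟨r, hr⟩ := hu.dX.2.isCompact.isBounded.exists_norm_le
  have hi : ∀ v : ℝ × ℝ → ℝ, SC v → ∀ t, Integrable (fun s => v (t, s) * sin (π * s)) := by
    intro v hv t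
    have h1 : Continuous (fun s => v (t, s) * sin (π * s)) := by have := hv.cont; fun_prop
    exact h1.integrable_of_hasCompactSupport (slice_cs hv.2 t).mul_right
  refine (hasDerivAt_integral_of_dominated_loc_of_deriv_le (F := fun t s => u (t, s) * sin (π * s))
    (F' := fun t s => dX u (t, s) * sin (π * s)) (x₀ := t) (s := univ)
    (bound := (Icc (-r) r).indicator fun _ => C) univ_mem ?_ ?_ ?_ ?_ ?_ ?_).2
  · exact Eventually.of_forall fun t => (hi u hu t).1
  · exact hi u hu t
  · exact (hi _ hu.dX t).1
  · refine Eventually.of_forall fun s x _ => ?_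
    by_cases hs : s ∈ Icc (-r) r
    · rw [indicator_of_mem hs, norm_mul]
      have h1 := hC (x, s)
      have h2 : ‖sin (π * s)‖ ≤ 1 := abs_sin_le_one _
      nlinarith [norm_nonneg (dX u (x, s)), norm_nonneg (sin (π * s))]
    · rw [indicator_of_notMem hs]
      have : dX u (x, s) = 0 := by
        by_contra h
        have := hr _ (subset_tsupport _ h)
        rw [Prod.norm_mk] at this
        exact hs (abs_le.1 ((le_max_right _ _).trans this))
      rw [this]; simp
  · rw [integrable_indicator_iff measurableSet_Icc]
    exact continuous_const.integrableOn_Icc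
  · refine Eventually.of_forall fun s x _ => ?_
    exact (hasDerivAt_dX hu.1 x s).mul_const _

lemma sco_contDiff (n : ℕ) : ∀ {u : ℝ × ℝ → ℝ}, SC u → ContDiff ℝ n (sco u) := by
  induction n with
  | zero =>
    intro u hu
    rw [Nat.cast_zero, contDiff_zero]
    exact continuous_iff_continuousAt.2 fun t => (sco_deriv hu t).continuousAt
  | succ n ih =>
    intro u hu
    rw [Nat.cast_succ, contDiff_succ_iff_deriv]
    refine ⟨fun t => (sco_deriv hu t).differentiableAt, by simp, ?_⟩
    have : deriv (sco u) = sco (dX u) := funext fun t => (sco_deriv hu t).deriv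
    rw [this]; exact ih hu.dX

lemma sco_SC {u : ℝ × ℝ → ℝ} (hu : SC u) : SC1 (sco u) := by
  constructor
  · rw [contDiff_infty]; exact fun n => sco_contDiff n hu
  · apply HasCompactSupport.intro (hu.2.isCompact.image continuous_fst)
    intro t ht
    have : ∀ s, u (t, s) = 0 := by
      intro s
      by_contra h
      exact ht ⟨(t, s), subset_tsupport _ h, rfl⟩
    simp [sco, this]

lemma cs_sq {X : Type*} [TopologicalSpace X] {f : X → ℝ} (h : HasCompactSupport f) :
    HasCompactSupport (fun p => f p ^ 2) :=
  h.comp_left (g := fun x : ℝ => x ^ 2) (by simp)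

lemma cs_combo {X : Type*} [TopologicalSpace X] {f g : X → ℝ} (c : X → ℝ)
    (hf : HasCompactSupport f) (hg : HasCompactSupport g) :
    HasCompactSupport (fun p => f p - c p * g p) :=
  (hf.sub (hg.mul_left (f := c)) : HasCompactSupport (f - c * g))

set_option maxHeartbeats 1000000 in
lemma trunc_core {ψ : ℝ × ℝ → ℝ} (hψ : SC ψ) {c0 A Λ B κ G0 δ : ℝ} {G ζ : ℝ → ℝ} (hA : 0 < A)
    (hG : Continuous G) (hGn : ∀ x, 0 ≤ G x) (hζ : ContDiff ℝ (⊤ : ℕ∞) ζ) (hζ0 : ∀ x, 0 ≤ ζ x)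
    (hζ1 : ∀ x, ζ x ≤ 1) (hκ : 0 ≤ κ) (hζd : ∀ x, |deriv ζ x| ≤ A⁻¹ * κ)
    (hout : ∀ x, ζ x ≠ 1 → G0 ≤ G x) (hG0 : 0 < G0)
    (hfib : ∀ x, (c0 + (A ^ 2)⁻¹ * G x) * ∫ y, ψ (x, y) ^ 2 ≤ ∫ y, dY ψ (x, y) ^ 2)
    (hD : ∫ p, gradSq ψ p ≤ (c0 + (A ^ 2)⁻¹ * Λ) * ∫ p, ψ p ^ 2) (hΛ : Λ ≤ B) (hB : 0 ≤ B)
    (hδ : 0 < δ)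
    (h1 : 2 * B ≤ G0) (h2 : (B + δ) * B ≤ G0 * (δ / 2)) (h3 : κ * (B + 1) + κ ^ 2 ≤ δ / 2) :
    SC (fun p : ℝ × ℝ => ζ p.1 * ψ p) ∧ ∫ p, ψ p ^ 2 ≤ 2 * ∫ p : ℝ × ℝ, (ζ p.1 * ψ p) ^ 2 ∧
    ∫ p, gradSq (fun p : ℝ × ℝ => ζ p.1 * ψ p) p ≤
      (c0 + (A ^ 2)⁻¹ * (Λ + δ)) * ∫ p : ℝ × ℝ, (ζ p.1 * ψ p) ^ 2 := by
  have hζc := hζ.continuous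
  have hψc := hψ.cont
  have hψ' : SC (fun p : ℝ × ℝ => ζ p.1 * ψ p) :=
    ⟨(hζ.comp contDiff_fst).mul hψ.1, hψ.2.mul_left⟩
  refine ⟨hψ', ?_⟩
  have eX : ∀ p : ℝ × ℝ, dX (fun p : ℝ × ℝ => ζ p.1 * ψ p) p = deriv ζ p.1 * ψ p + ζ p.1 * dX ψ p := by
    intro p
    exact ((hζ.differentiable (by simp) p.1).hasDerivAt.mul (hasDerivAt_dX hψ.1 p.1 p.2)).deriv
  have eY : ∀ p : ℝ × ℝ, dY (fun p : ℝ × ℝ => ζ p.1 * ψ p) p = ζ p.1 * dY ψ p := by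
    intro p
    exact ((hasDerivAt_dY hψ.1 p.1 p.2).const_mul (ζ p.1)).deriv
  have iN : Integrable (fun p => ψ p ^ 2) := integrable_sq_cs hψ.cont hψ.2
  have iX : Integrable (fun p => dX ψ p ^ 2) := integrable_sq_cs hψ.dX.cont hψ.dX.2
  have iY : Integrable (fun p => dY ψ p ^ 2) := integrable_sq_cs hψ.dY.cont hψ.dY.2
  have iN' : Integrable (fun p : ℝ × ℝ => (ζ p.1 * ψ p) ^ 2) := integrable_sq_cs hψ'.cont hψ'.2
  have iX' : Integrable (fun p => dX (fun p : ℝ × ℝ => ζ p.1 * ψ p) p ^ 2) :=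
    integrable_sq_cs hψ'.dX.cont hψ'.dX.2
  have iY' : Integrable (fun p => dY (fun p : ℝ × ℝ => ζ p.1 * ψ p) p ^ 2) :=
    integrable_sq_cs hψ'.dY.cont hψ'.dY.2
  have iG : Integrable (fun p : ℝ × ℝ => G p.1 * ψ p ^ 2) :=
    integrable_mul_sq (by fun_prop) hψ.cont hψ.2
  set N := ∫ p, ψ p ^ 2 with hN
  set X := ∫ p, dX ψ p ^ 2 with hX
  set Y := ∫ p, dY ψ p ^ 2 with hY
  set N' := ∫ p : ℝ × ℝ, (ζ p.1 * ψ p) ^ 2 with hN'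
  set W := ∫ p : ℝ × ℝ, G p.1 * ψ p ^ 2 with hW
  have hcY : Continuous (dY ψ) := hψ.dY.cont
  have csN : HasCompactSupport (fun p => ψ p ^ 2) := cs_sq hψ.2
  have csY : HasCompactSupport (fun p => dY ψ p ^ 2) := cs_sq hψ.dY.2
  have sN : ∀ x, 0 ≤ ∫ y, ψ (x, y) ^ 2 := fun x => integral_nonneg fun y => sq_nonneg _
  have iNs : ∀ x, Integrable fun y => ψ (x, y) ^ 2 := fun x => slice_cint (by fun_prop) csN x
  have iYs : ∀ x, Integrable fun y => dY ψ (x, y) ^ 2 := fun x => slice_cint (by fun_prop) csY x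
  -- main positivity
  have f1 : (A ^ 2)⁻¹ * W ≤ Y - c0 * N := by
    have := fub_nonneg (ρ := fun _ => 1) continuous_const (fun _ => zero_le_one)
      (f := fun p => dY ψ p ^ 2 - (c0 + (A ^ 2)⁻¹ * G p.1) * ψ p ^ 2) (by fun_prop)
      (cs_combo (fun p : ℝ × ℝ => c0 + (A ^ 2)⁻¹ * G p.1) csY csN) (fun x => by
        change 0 ≤ ∫ y, (dY ψ (x, y) ^ 2 - (c0 + (A ^ 2)⁻¹ * G x) * ψ (x, y) ^ 2)
        rw [integral_sub (iYs x) ((iNs x).const_mul _), integral_const_mul]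
        linarith [hfib x])
    have e : ∀ p : ℝ × ℝ, 1 * (dY ψ p ^ 2 - (c0 + (A ^ 2)⁻¹ * G p.1) * ψ p ^ 2) =
      dY ψ p ^ 2 - c0 * ψ p ^ 2 - (A ^ 2)⁻¹ * (G p.1 * ψ p ^ 2) := fun p => by ring
    simp only [e] at this
    have i1 : Integrable (fun p => dY ψ p ^ 2 - c0 * ψ p ^ 2) := iY.sub (iN.const_mul _)
    rw [integral_sub i1 (iG.const_mul _), integral_sub iY (iN.const_mul _),
      integral_const_mul, integral_const_mul] at this
    linarith
  have f2 : (∫ p, dY (fun p : ℝ × ℝ => ζ p.1 * ψ p) p ^ 2) - c0 * N' ≤ Y - c0 * N := by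
    have := fub_nonneg (ρ := fun x => 1 - ζ x ^ 2) (by fun_prop)
      (fun x => by have := hζ0 x; have := hζ1 x; nlinarith)
      (f := fun p => dY ψ p ^ 2 - c0 * ψ p ^ 2) (by fun_prop)
      (cs_combo (fun _ : ℝ × ℝ => c0) csY csN) (fun x => by
        rw [integral_sub (iYs x) ((iNs x).const_mul _), integral_const_mul]
        have := hfib x
        have h4 : 0 ≤ (A ^ 2)⁻¹ * G x * ∫ y, ψ (x, y) ^ 2 := by
          have := hGn x; have := sN x; positivity
        linarith)
    have e : ∀ p : ℝ × ℝ, (1 - ζ p.1 ^ 2) * (dY ψ p ^ 2 - c0 * ψ p ^ 2) =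
      dY ψ p ^ 2 - c0 * ψ p ^ 2 - (dY (fun p : ℝ × ℝ => ζ p.1 * ψ p) p ^ 2 - c0 * (ζ p.1 * ψ p) ^ 2) := by
      intro p; rw [eY]; ring
    simp only [e] at this
    have i1 : Integrable (fun p => dY ψ p ^ 2 - c0 * ψ p ^ 2) := iY.sub (iN.const_mul _)
    have i2 : Integrable (fun p : ℝ × ℝ => dY (fun p : ℝ × ℝ => ζ p.1 * ψ p) p ^ 2 -
      c0 * (ζ p.1 * ψ p) ^ 2) := iY'.sub (iN'.const_mul _)
    rw [integral_sub i1 i2,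
      integral_sub iY (iN.const_mul _), integral_sub iY' (iN'.const_mul _),
      integral_const_mul, integral_const_mul] at this
    linarith
  have f3 : ∫ p, dX (fun p : ℝ × ℝ => ζ p.1 * ψ p) p ^ 2 ≤
      (1 + κ) * X + (κ + κ ^ 2) * ((A ^ 2)⁻¹ * N) := by
    rw [hX, hN, ← integral_const_mul, ← integral_const_mul, ← integral_const_mul,
      ← integral_add (iX.const_mul _) ((iN.const_mul _).const_mul _)]
    apply integral_mono iX' ((iX.const_mul _).add ((iN.const_mul _).const_mul _))
    intro p
    change _ ≤ (1 + κ) * dX ψ p ^ 2 + (κ + κ ^ 2) * ((A ^ 2)⁻¹ * ψ p ^ 2)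
    simp only [eX]
    have d1 := abs_le.1 (hζd p.1)
    set d := deriv ζ p.1
    set z := ζ p.1 with hz
    have z0 : 0 ≤ z := hζ0 _
    have z1 : z ≤ 1 := hζ1 _
    have d2 : d ^ 2 ≤ (A⁻¹ * κ) ^ 2 := sq_le_sq' d1.1 d1.2
    have d3 : (d * ψ p) ^ 2 ≤ κ ^ 2 * ((A ^ 2)⁻¹ * ψ p ^ 2) := by
      calc (d * ψ p) ^ 2 = d ^ 2 * ψ p ^ 2 := by ring
        _ ≤ (A⁻¹ * κ) ^ 2 * ψ p ^ 2 := by gcongr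
        _ = _ := by rw [mul_pow, inv_pow]; ring
    have d4 : (z * dX ψ p) ^ 2 ≤ dX ψ p ^ 2 := by
      have : z ^ 2 ≤ 1 := by nlinarith
      calc (z * dX ψ p) ^ 2 = z ^ 2 * dX ψ p ^ 2 := by ring
        _ ≤ 1 * dX ψ p ^ 2 := by gcongr
        _ = _ := one_mul _
    have d5 : 2 * (d * ψ p) * (z * dX ψ p) ≤ κ * ((A ^ 2)⁻¹ * ψ p ^ 2) + κ * dX ψ p ^ 2 := by
      -- |d| ≤ κ / A
      have e1 : 2 * (d * ψ p) * (z * dX ψ p) ≤ κ * (2 * |A⁻¹ * ψ p| * |z * dX ψ p|) := by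
        calc 2 * (d * ψ p) * (z * dX ψ p) ≤ |2 * (d * ψ p) * (z * dX ψ p)| := le_abs_self _
          _ = |d| * (2 * |ψ p| * |z * dX ψ p|) := by
            rw [abs_mul, abs_mul, abs_mul]; simp; ring
          _ ≤ (A⁻¹ * κ) * (2 * |ψ p| * |z * dX ψ p|) := by gcongr; exact hζd p.1
          _ = _ := by rw [abs_mul A⁻¹, abs_of_pos (inv_pos.2 hA)]; ring
      have e2 : 2 * |A⁻¹ * ψ p| * |z * dX ψ p| ≤ (A⁻¹ * ψ p) ^ 2 + (z * dX ψ p) ^ 2 := by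
        rw [← sq_abs (A⁻¹ * ψ p), ← sq_abs (z * dX ψ p)]
        nlinarith [sq_nonneg (|A⁻¹ * ψ p| - |z * dX ψ p|)]
      have e3 : (A⁻¹ * ψ p) ^ 2 = (A ^ 2)⁻¹ * ψ p ^ 2 := by rw [mul_pow, inv_pow]
      rw [e3] at e2
      calc _ ≤ _ := e1
        _ ≤ κ * ((A ^ 2)⁻¹ * ψ p ^ 2 + (z * dX ψ p) ^ 2) := by gcongr
        _ ≤ κ * ((A ^ 2)⁻¹ * ψ p ^ 2 + dX ψ p ^ 2) := by gcongr
        _ = _ := by ring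
    nlinarith
  have f4 : G0 * (N - N') ≤ W := by
    rw [hN, hN', ← integral_sub iN iN', ← integral_const_mul]
    apply integral_mono ((iN.sub iN').const_mul _) iG
    intro p
    change G0 * (ψ p ^ 2 - (ζ p.1 * ψ p) ^ 2) ≤ G p.1 * ψ p ^ 2
    by_cases hz : ζ p.1 = 1
    · rw [hz]; have := hGn p.1; ring_nf; positivity
    · have := hout _ hz
      have h5 : 0 ≤ G0 * (ζ p.1 * ψ p) ^ 2 := by positivity
      have h6 : G0 * ψ p ^ 2 ≤ G p.1 * ψ p ^ 2 := by gcongr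
      linarith
  have f5 : N' ≤ N := by
    apply integral_mono iN' iN
    intro p
    simp only
    have : ζ p.1 ^ 2 ≤ 1 := by have := hζ0 p.1; have := hζ1 p.1; nlinarith
    calc (ζ p.1 * ψ p) ^ 2 = ζ p.1 ^ 2 * ψ p ^ 2 := by ring
      _ ≤ 1 * ψ p ^ 2 := by gcongr
      _ = _ := one_mul _
  have hN0 : 0 ≤ N := integral_nonneg fun _ => sq_nonneg _
  have hX0 : 0 ≤ X := integral_nonneg fun _ => sq_nonneg _
  have hW0 : 0 ≤ W := integral_nonneg fun p => by have := hGn p.1; positivity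
  rw [gradSq_eq, integral_add iX iY] at hD
  rw [gradSq_eq, integral_add iX' iY']
  change X + Y ≤ _ at hD
  have hA2 : 0 < A ^ 2 := by positivity
  obtain ⟨X1, hX1⟩ : ∃ X1, X = (A ^ 2)⁻¹ * X1 := ⟨A ^ 2 * X, by field_simp⟩
  have hAi : 0 < (A ^ 2)⁻¹ := by positivity
  have hX10 : 0 ≤ X1 := by
    rw [hX1] at hX0; exact nonneg_of_mul_nonneg_right hX0 hAi
  have k1 : X1 + W ≤ Λ * N := by
    have : (A ^ 2)⁻¹ * (X1 + W) ≤ (A ^ 2)⁻¹ * (Λ * N) := by rw [hX1] at hD; linarith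
    exact le_of_mul_le_mul_left this hAi
  have k2 : Λ * N ≤ B * N := by gcongr
  have k3 : G0 * (N - N') ≤ B * N := by linarith
  constructor
  · have : B * N ≤ G0 / 2 * N := by gcongr; linarith
    have : G0 * (N - N') ≤ G0 * (N / 2) := by linarith
    have := le_of_mul_le_mul_left this hG0
    linarith
  · have k4 : (Λ + δ) * (N - N') ≤ δ / 2 * N := by
      rcases le_total (Λ + δ) 0 with h | h
      · have : (Λ + δ) * (N - N') ≤ 0 := mul_nonpos_of_nonpos_of_nonneg h (by linarith)
        have : 0 ≤ δ / 2 * N := by positivity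
        linarith
      · apply le_of_mul_le_mul_left _ hG0
        calc G0 * ((Λ + δ) * (N - N')) = (Λ + δ) * (G0 * (N - N')) := by ring
          _ ≤ (Λ + δ) * (B * N) := by gcongr
          _ ≤ (B + δ) * (B * N) := by gcongr
          _ = ((B + δ) * B) * N := by ring
          _ ≤ (G0 * (δ / 2)) * N := by gcongr
          _ = _ := by ring
    have k5 : κ * X1 ≤ κ * (B * N) := by gcongr; linarith
    have k6 : (κ * (B + 1) + κ ^ 2) * N ≤ δ / 2 * N := by gcongr
    have k7 : Y - c0 * N ≤ (A ^ 2)⁻¹ * (Λ * N - X1) := by rw [hX1] at hD; linarith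
    have k8 : (1 + κ) * X1 + (κ + κ ^ 2) * N + (Λ * N - X1) ≤ (Λ + δ) * N' := by linarith
    have k9 := mul_le_mul_of_nonneg_left k8 hAi.le
    rw [hX1] at f3
    linarith

lemma fub_ge {f : ℝ × ℝ → ℝ} (hf : Continuous f) (hc : HasCompactSupport f) {r : ℝ → ℝ}
    (hr : Integrable r) (h : ∀ t, r t ≤ ∫ y, f (t, y)) : ∫ t, r t ≤ ∫ p, f p := by
  have hi : Integrable f (volume.prod volume) := hf.integrable_of_hasCompactSupport hc
  rw [fub_eq hf hc]
  exact integral_mono hr hi.integral_prod_left h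

set_option maxHeartbeats 1000000 in
lemma lower_core {ψ : ℝ × ℝ → ℝ} (hψ : SC ψ) {A L R Λ κ s δ δ₂ : ℝ} {w q : ℝ → ℝ}
    (hA : 0 < A) (hL : 0 < L) (hw : ContDiff ℝ (⊤ : ℕ∞) w) (hq : Continuous q) (hq0 : ∀ t, 0 ≤ q t)
    (hκ : 0 ≤ κ) (hκ1 : κ < 1)
    (hu0 : ∀ t σ, σ ∉ Ioo (0:ℝ) 1 → trf A L w ψ (t, σ) = 0)
    (huR : ∀ t, t ∉ Icc (-R) R → ∀ σ, trf A L w ψ (t, σ) = 0)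
    (hwκ : ∀ t ∈ Icc (-R) R, |deriv w t| ≤ κ)
    (hs1 : ∀ t ∈ Icc (-R) R, 2 * κ * (A ^ 2)⁻¹ ≤ s * ((L ^ 2)⁻¹ * exp (2 * w t)))
    (hs : s ≤ 1)
    (hpot : ∀ t ∈ Icc (-R) R, π ^ 2 * (L ^ 2)⁻¹ + (A ^ 2)⁻¹ * (q t - δ₂) ≤
      (1 - s) * (π ^ 2 * ((L ^ 2)⁻¹ * exp (2 * w t))))
    (hpot2 : ∀ t ∈ Icc (-R) R, (3 / 2) * (L ^ 2)⁻¹ ≤ (1 - s) * (4 * ((L ^ 2)⁻¹ * exp (2 * w t))))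
    (hD : ∫ p, gradSq ψ p ≤ (π ^ 2 * (L ^ 2)⁻¹ + (A ^ 2)⁻¹ * Λ) * ∫ p, ψ p ^ 2)
    (hgap : (A ^ 2)⁻¹ * (Λ + κ / 2) < π ^ 2 * (L ^ 2)⁻¹ / 2)
    (hδ : Λ + κ / 2 + δ₂ ≤ (1 - κ) * (Λ + δ)) :
    (∫ t, (deriv (fun t => √2 * sco (trf A L w ψ) t) t ^ 2 + q t * (√2 * sco (trf A L w ψ) t) ^ 2)
      ≤ (Λ + δ) * ∫ t, (√2 * sco (trf A L w ψ) t) ^ 2) ∧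
    ((∀ t, √2 * sco (trf A L w ψ) t = 0) → ψ = 0) := by
  have hu : SC (trf A L w ψ) := SC.trf_sc hA hL hw hψ
  have hN := trans_norm hA hL hw hψ
  have hXe := trans_Xenergy hA hL hw hψ
  have hYe := trans_Yenergy hA hL hw hψ
  have hwc := hw.continuous
  have hwd : Continuous (deriv w) := hw.continuous_deriv (by simp)
  set u := trf A L w ψ with hudef
  have huc := hu.cont
  have hXc := hu.dX.cont
  have hYc := hu.dY.cont
  have hXz : ∀ t σ, σ ∉ Ioo (0:ℝ) 1 → dX u (t, σ) = 0 := by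
    intro t σ hσ
    have : (fun s => u (s, σ)) = fun _ => 0 := funext fun s => hu0 s σ hσ
    simp only [dX, this]; simp
  have hsl : ∀ t, ContDiff ℝ 1 (fun σ => u (t, σ)) := fun t =>
    (slice_contDiff hu.1 t).of_le (by norm_cast)
  have hslX : ∀ t, ContDiff ℝ 1 (fun σ => dX u (t, σ)) := fun t =>
    (slice_contDiff hu.dX.1 t).of_le (by norm_cast)
  have hYz : ∀ t σ, σ ∉ Ioo (0:ℝ) 1 → dY u (t, σ) = 0 := by
    intro t σ hσ
    exact deriv_zero_out (hsl t) (hu0 t) σ hσ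
  have hYR : ∀ t, t ∉ Icc (-R) R → ∀ σ, dY u (t, σ) = 0 := by
    intro t ht σ
    have : (fun s => u (t, s)) = fun _ => 0 := funext fun s => huR t ht s
    simp only [dY, this]; simp
  -- chi
  have hχ0 := sco_SC hu
  have hχ : SC1 (fun t => √2 * sco u t) :=
    ⟨contDiff_const.mul hχ0.1, (hχ0.2.mul_left : HasCompactSupport ((fun _ => √2) * sco u))⟩
  have hχd : ∀ t, deriv (fun t => √2 * sco u t) t = √2 * sco (dX u) t := fun t =>
    ((sco_deriv hu t).const_mul _).deriv
  have sq2 : √2 ^ 2 = (2:ℝ) := Real.sq_sqrt (by norm_num)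
  have fib1 : ∀ t, (√2 * sco u t) ^ 2 ≤ ∫ σ, u (t, σ) ^ 2 := by
    intro t
    have := (fiber_main (hsl t) (hu0 t)).1
    rw [mul_pow, sq2]; exact this
  have fib2 : ∀ t, (√2 * sco (dX u) t) ^ 2 ≤ ∫ σ, dX u (t, σ) ^ 2 := by
    intro t
    have := (fiber_main (hslX t) (hXz t)).1
    rw [mul_pow, sq2]; exact this
  have fib3 : ∀ t, 4 * π ^ 2 * (∫ σ, u (t, σ) ^ 2) - 3 * π ^ 2 * (√2 * sco u t) ^ 2 ≤
      ∫ σ, dY u (t, σ) ^ 2 := by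
    intro t
    have h2 := (fiber_main (hsl t) (hu0 t)).2
    have h3 : 3 * π ^ 2 * (√2 * sco u t) ^ 2 = 6 * π ^ 2 * (sco u t) ^ 2 := by
      rw [mul_pow, sq2]; ring
    rw [h3]; exact h2
  have csu : HasCompactSupport (fun p => u p ^ 2) := cs_sq hu.2
  have csX : HasCompactSupport (fun p => dX u p ^ 2) := cs_sq hu.dX.2
  have csY : HasCompactSupport (fun p => dY u p ^ 2) := cs_sq hu.dY.2
  have iu : Integrable (fun p => u p ^ 2) := integrable_sq_cs huc hu.2
  have iX : Integrable (fun p => dX u p ^ 2) := integrable_sq_cs hXc hu.dX.2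
  have iY : Integrable (fun p : ℝ × ℝ => exp (2 * w p.1) * dY u p ^ 2) :=
    integrable_mul_sq (by fun_prop) hYc hu.dY.2
  have icχ : Integrable (fun t => (√2 * sco u t) ^ 2) := integrable_sq_cs hχ.cont hχ.2
  have icχ' : Integrable (fun t => deriv (fun t => √2 * sco u t) t ^ 2) :=
    integrable_sq_cs hχ.deriv.cont hχ.deriv.2
  have icq : Integrable (fun t => q t * (√2 * sco u t) ^ 2) := integrable_mul_sq hq hχ.cont hχ.2
  have slu : ∀ t, Integrable fun σ => u (t, σ) ^ 2 := fun t => slice_cint (by fun_prop) csu t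
  have slX : ∀ t, Integrable fun σ => dX u (t, σ) ^ 2 := fun t => slice_cint (by fun_prop) csX t
  have slY : ∀ t, Integrable fun σ => dY u (t, σ) ^ 2 := fun t => slice_cint (by fun_prop) csY t
  have hAi : 0 < (A ^ 2)⁻¹ := by positivity
  have hLi : 0 < (L ^ 2)⁻¹ := by positivity
  have hπ := pi_pos
  set c0 := π ^ 2 * (L ^ 2)⁻¹ with hc0
  have hc0p : 0 < c0 := by positivity
  set a2 := (A ^ 2)⁻¹ with ha2
  set l2 := (L ^ 2)⁻¹ with hl2
  set N := ∫ p, u p ^ 2 with hNd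
  set X := ∫ p, dX u p ^ 2 with hXd
  set Y := ∫ p : ℝ × ℝ, exp (2 * w p.1) * dY u p ^ 2 with hYd
  set Nc := ∫ t, (√2 * sco u t) ^ 2 with hNc
  set Xc := ∫ t, deriv (fun t => √2 * sco u t) t ^ 2 with hXcd
  set Q := ∫ t, q t * (√2 * sco u t) ^ 2 with hQ
  -- Step 1
  have st1 : a2 * (1 - κ) * X - a2 * (κ / 2) * N + (1 - s) * l2 * Y ≤ (c0 + a2 * Λ) * N := by
    have h1 : a2 * (1 - κ) * X - a2 * (κ / 2) * N + (1 - s) * l2 * Y - l2 * Y ≤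
        ∫ p : ℝ × ℝ, a2 * (dX u p + deriv w p.1 * (u p / 2 + p.2 * dY u p)) ^ 2 := by
      rw [hXd, hNd, hYd, ← integral_const_mul, ← integral_const_mul, ← integral_const_mul,
        ← integral_const_mul]
      have j1 : Integrable (fun p => a2 * (1 - κ) * dX u p ^ 2 - a2 * (κ / 2) * u p ^ 2) :=
        (iX.const_mul _).sub (iu.const_mul _)
      have j2 : Integrable (fun p : ℝ × ℝ => a2 * (1 - κ) * dX u p ^ 2 - a2 * (κ / 2) * u p ^ 2 +
        (1 - s) * l2 * (exp (2 * w p.1) * dY u p ^ 2)) := j1.add (iY.const_mul _)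
      have j3 : Integrable (fun p : ℝ × ℝ => a2 * (dX u p + deriv w p.1 * (u p / 2 + p.2 * dY u p)) ^ 2) := by
        apply Integrable.const_mul
        have k1 : HasCompactSupport (fun p : ℝ × ℝ => (1/2 : ℝ) * u p) := hu.2.mul_left
        have k2 : HasCompactSupport (fun p : ℝ × ℝ => p.2 * dY u p) := hu.dY.2.mul_left
        have k3 : HasCompactSupport (fun p : ℝ × ℝ => deriv w p.1 * (1/2 * u p + p.2 * dY u p)) :=
          (k1.add k2).mul_left
        have k4 : HasCompactSupport (fun p : ℝ × ℝ => dX u p + deriv w p.1 * (1/2 * u p + p.2 * dY u p)) :=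
          hu.dX.2.add k3
        have k5 : (fun p : ℝ × ℝ => dX u p + deriv w p.1 * (u p / 2 + p.2 * dY u p)) =
          (fun p : ℝ × ℝ => dX u p + deriv w p.1 * (1/2 * u p + p.2 * dY u p)) := by
          funext p; ring
        have k6 : HasCompactSupport (fun p : ℝ × ℝ => dX u p + deriv w p.1 * (u p / 2 + p.2 * dY u p)) := by
          rw [k5]; exact k4
        exact integrable_sq_cs (by fun_prop) k6
      rw [← integral_sub (iX.const_mul _) (iu.const_mul _), ← integral_add j1 (iY.const_mul _),
        ← integral_sub j2 (iY.const_mul _)]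
      apply integral_mono (j2.sub (iY.const_mul _)) j3
      rintro ⟨t, σ⟩
      change a2 * (1 - κ) * dX u (t, σ) ^ 2 - a2 * (κ / 2) * u (t, σ) ^ 2 +
        (1 - s) * l2 * (exp (2 * w t) * dY u (t, σ) ^ 2) - l2 * (exp (2 * w t) * dY u (t, σ) ^ 2) ≤
        a2 * (dX u (t, σ) + deriv w t * (u (t, σ) / 2 + σ * dY u (t, σ))) ^ 2
      by_cases ht : t ∈ Icc (-R) R
      · have hd := hwκ t ht
        have hs1' := mul_le_mul_of_nonneg_right (hs1 t ht) (sq_nonneg (dY u (t, σ)))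
        have he : (u (t, σ) / 2 + σ * dY u (t, σ)) ^ 2 ≤ u (t, σ) ^ 2 / 2 + 2 * dY u (t, σ) ^ 2 := by
          by_cases hσ : σ ∈ Ioo (0:ℝ) 1
          · have h3 : σ ^ 2 * dY u (t, σ) ^ 2 ≤ 1 * dY u (t, σ) ^ 2 := by
              gcongr; nlinarith [hσ.1, hσ.2]
            nlinarith [sq_nonneg (u (t, σ) / 2 - σ * dY u (t, σ))]
          · rw [hu0 t σ hσ, hYz t σ hσ]; norm_num
        set d := deriv w t
        set v := dX u (t, σ)
        set e := u (t, σ) / 2 + σ * dY u (t, σ)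
        have h4 : v ^ 2 - κ * (v ^ 2 + e ^ 2) ≤ (v + d * e) ^ 2 := by
          have := abs_le.1 hd
          have h5 : - (κ * (v ^ 2 + e ^ 2)) ≤ 2 * d * (v * e) := by
            rcases le_total 0 (v * e) with h | h
            · nlinarith [sq_nonneg (v - e)]
            · nlinarith [sq_nonneg (v + e)]
          nlinarith [sq_nonneg (d * e)]
        have h6 := mul_le_mul_of_nonneg_left h4 hAi.le
        have h7 : a2 * κ * e ^ 2 ≤ a2 * κ * (u (t, σ) ^ 2 / 2 + 2 * dY u (t, σ) ^ 2) := by gcongr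
        linarith
      · rw [huR t ht, hYR t ht]
        have : 0 ≤ a2 * κ * dX u (t, σ) ^ 2 := by positivity
        linarith
    rw [gradSq_eq, integral_add (integrable_sq_cs hψ.dX.cont hψ.dX.2)
      (integrable_sq_cs hψ.dY.cont hψ.dY.2), hXe, hYe, hN] at hD
    rw [integral_const_mul (l2)] at hD
    have hAL : 0 < A * L := by positivity
    have h2 : A * L * ((∫ p : ℝ × ℝ, a2 * (dX u p + deriv w p.1 * (u p / 2 + p.2 * dY u p)) ^ 2)
        + l2 * Y) ≤ A * L * ((c0 + a2 * Λ) * N) := by linarith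
    have h3 := le_of_mul_le_mul_left h2 hAL
    linarith
  -- Step 2
  have st2 : a2 * (1 - κ) * Xc - c0 / 2 * Nc + a2 * (Q - δ₂ * Nc) ≤
      a2 * (1 - κ) * X + (1 - s) * l2 * Y - 3 / 2 * c0 * N := by
    have j1 : Integrable (fun p : ℝ × ℝ => a2 * (1 - κ) * dX u p ^ 2 + (1 - s) * l2 * (exp (2 * w p.1) * dY u p ^ 2)) :=
      (iX.const_mul _).add (iY.const_mul _)
    have i1 : Integrable (fun t => a2 * (1 - κ) * deriv (fun t => √2 * sco u t) t ^ 2 -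
      c0 / 2 * (√2 * sco u t) ^ 2) := (icχ'.const_mul _).sub (icχ.const_mul _)
    have i2 : Integrable (fun t => q t * (√2 * sco u t) ^ 2 - δ₂ * (√2 * sco u t) ^ 2) :=
      icq.sub (icχ.const_mul _)
    have eL : ∫ t, (a2 * (1 - κ) * deriv (fun t => √2 * sco u t) t ^ 2 -
      c0 / 2 * (√2 * sco u t) ^ 2 + a2 * (q t * (√2 * sco u t) ^ 2 - δ₂ * (√2 * sco u t) ^ 2)) =
      a2 * (1 - κ) * Xc - c0 / 2 * Nc + a2 * (Q - δ₂ * Nc) := by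
      rw [integral_add i1 (i2.const_mul _), integral_sub (icχ'.const_mul _) (icχ.const_mul _),
        integral_const_mul, integral_const_mul, integral_const_mul, integral_sub icq (icχ.const_mul _),
        integral_const_mul]
    have eR : ∫ p : ℝ × ℝ, (a2 * (1 - κ) * dX u p ^ 2 + (1 - s) * l2 * (exp (2 * w p.1) * dY u p ^ 2)
      - 3 / 2 * c0 * u p ^ 2) = a2 * (1 - κ) * X + (1 - s) * l2 * Y - 3 / 2 * c0 * N := by
      rw [integral_sub j1 (iu.const_mul _), integral_add (iX.const_mul _) (iY.const_mul _),
        integral_const_mul, integral_const_mul, integral_const_mul]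
    rw [← eL, ← eR]
    apply fub_ge (by fun_prop)
    · have k1 : HasCompactSupport (fun p : ℝ × ℝ => a2 * (1 - κ) * dX u p ^ 2) := csX.mul_left
      have k2 : HasCompactSupport (fun p : ℝ × ℝ => exp (2 * w p.1) * dY u p ^ 2) := csY.mul_left
      have k3 : HasCompactSupport (fun p : ℝ × ℝ => (1 - s) * l2 * (exp (2 * w p.1) * dY u p ^ 2)) :=
        k2.mul_left
      have k4 : HasCompactSupport (fun p : ℝ × ℝ => a2 * (1 - κ) * dX u p ^ 2 +
        (1 - s) * l2 * (exp (2 * w p.1) * dY u p ^ 2)) := k1.add k3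
      exact cs_combo (fun _ => 3 / 2 * c0) k4 csu
    · exact i1.add (i2.const_mul _)
    · intro t
      rw [hχd]
      have jj : Integrable (fun σ => a2 * (1 - κ) * dX u (t, σ) ^ 2 +
        (1 - s) * l2 * (exp (2 * w t) * dY u (t, σ) ^ 2)) :=
        ((slX t).const_mul _).add (((slY t).const_mul _).const_mul _)
      change _ ≤ ∫ σ, (a2 * (1 - κ) * dX u (t, σ) ^ 2 + (1 - s) * l2 * (exp (2 * w t) * dY u (t, σ) ^ 2)
        - 3 / 2 * c0 * u (t, σ) ^ 2)
      rw [integral_sub jj ((slu t).const_mul _),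
        integral_add ((slX t).const_mul _) (((slY t).const_mul _).const_mul _),
        integral_const_mul, integral_const_mul, integral_const_mul, integral_const_mul]
      have g1 := fib1 t
      have g2 := fib2 t
      have g3 := fib3 t
      have g2' : a2 * (1 - κ) * (√2 * sco (dX u) t) ^ 2 ≤ a2 * (1 - κ) * ∫ σ, dX u (t, σ) ^ 2 := by
        apply mul_le_mul_of_nonneg_left g2
        have : 0 < 1 - κ := by linarith
        positivity
      by_cases ht : t ∈ Icc (-R) R
      · have p1 := hpot t ht
        have p2 := hpot2 t ht
        set U := ∫ σ, u (t, σ) ^ 2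
        set c := (√2 * sco u t) ^ 2 with hcdef
        have hc : 0 ≤ c := sq_nonneg _
        set E := l2 * exp (2 * w t) with hE
        have hs' : 0 ≤ (1 - s) * E := by
          have : 0 ≤ 1 - s := by linarith
          positivity
        have q1 : (1 - s) * E * (4 * π ^ 2 * U - 3 * π ^ 2 * c) ≤
          (1 - s) * E * ∫ σ, dY u (t, σ) ^ 2 := mul_le_mul_of_nonneg_left g3 hs'
        have q2 := mul_le_mul_of_nonneg_right p1 hc
        have q3 := mul_le_mul_of_nonneg_right p2 (by
          have : 0 ≤ U - c := by linarith
          positivity : 0 ≤ π ^ 2 * (U - c))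
        have q4 : (1 - s) * l2 * (exp (2 * w t) * ∫ σ, dY u (t, σ) ^ 2) =
          (1 - s) * E * ∫ σ, dY u (t, σ) ^ 2 := by rw [hE]; ring
        rw [q4]
        have q5 : 3 / 2 * l2 * (π ^ 2 * (U - c)) = 3 / 2 * c0 * (U - c) := by rw [hc0]; ring
        rw [q5] at q3
        linarith
      · have z1 : ∫ σ, u (t, σ) ^ 2 = 0 := by simp [huR t ht]
        have z2 : ∫ σ, dY u (t, σ) ^ 2 = 0 := by simp [hYR t ht]
        have z3 : sco u t = 0 := by simp [sco, huR t ht]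
        rw [z1, z2, z3]
        linarith
  have hNN : Nc ≤ N := fub_ge (by fun_prop) csu icχ fib1
  have hNc0 : 0 ≤ Nc := integral_nonneg fun _ => sq_nonneg _
  have hXc0 : 0 ≤ Xc := integral_nonneg fun _ => sq_nonneg _
  have hQ0 : 0 ≤ Q := integral_nonneg fun t => by have := hq0 t; positivity
  have main : a2 * ((1 - κ) * Xc + Q) + (c0 / 2) * (N - Nc) ≤ a2 * ((Λ + κ / 2) * N + δ₂ * Nc) := by
    linarith
  constructor
  · rw [integral_add icχ' icq]
    change Xc + Q ≤ (Λ + δ) * Nc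
    have h1 : a2 * (Λ + κ / 2) * (N - Nc) ≤ c0 / 2 * (N - Nc) :=
      mul_le_mul_of_nonneg_right hgap.le (by linarith)
    have h2 : a2 * ((1 - κ) * Xc + Q) ≤ a2 * ((Λ + κ / 2 + δ₂) * Nc) := by linarith
    have h3 := le_of_mul_le_mul_left h2 hAi
    have h4 : (Λ + κ / 2 + δ₂) * Nc ≤ (1 - κ) * (Λ + δ) * Nc := by gcongr
    have h5 : 0 ≤ κ * Q := by positivity
    have h6 : (1 - κ) * (Xc + Q) ≤ (1 - κ) * ((Λ + δ) * Nc) := by linarith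
    exact le_of_mul_le_mul_left h6 (by linarith)
  · intro hz
    have z1 : Nc = 0 := by rw [hNc]; simp only [hz]; simp
    rw [z1] at main hNN
    have : 0 ≤ a2 * ((1 - κ) * Xc + Q) := by
      have : 0 ≤ 1 - κ := by linarith
      positivity
    have h1 : (c0 / 2 - a2 * (Λ + κ / 2)) * N ≤ 0 := by linarith
    have h2 : N = 0 := by
      by_contra h
      have : 0 < N := lt_of_le_of_ne hNN (Ne.symm h)
      have := mul_pos (sub_pos.2 hgap) this
      linarith
    rw [h2, mul_zero] at hN
    by_contra h
    have := integral_sq_pos (μ := volume) hψ.cont hψ.2 h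
    linarith

lemma inv_sq_lower {h M d : ℝ} (hh : 0 < h) (hd : 0 ≤ d) (hM : 0 < M) (hle : h ≤ M - d) :
    1 / M ^ 2 + 2 * d / M ^ 3 ≤ 1 / h ^ 2 := by
  have h1 : 1 / M ^ 2 + 2 * d / M ^ 3 = (M + 2 * d) / M ^ 3 := by field_simp
  rw [h1, div_le_div_iff₀ (by positivity) (by positivity)]
  have h2 : h ^ 2 ≤ (M - d) ^ 2 := by gcongr
  have h3 : (M + 2 * d) * h ^ 2 ≤ (M + 2 * d) * (M - d) ^ 2 := by gcongr
  have h4 : 0 ≤ d ^ 2 * (3 * M - 2 * d) := mul_nonneg (sq_nonneg _) (by linarith)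
  nlinarith

lemma fib_bound {a b : ℝ} {h : ℝ → ℝ} {m α M c' ε : ℝ} (hm : 1 ≤ m) (hα : α = 2 / (m + 2))
    (hM : 0 < M) (hc' : 0 < c') (hε : 0 < ε)
    (hglob : ∀ x ∈ Icc (-a) b, h x ≤ M - c' * |x| ^ m)
    {ψ : ℝ × ℝ → ℝ} (hψ : SC ψ) (hs : tsupport ψ ⊆ dom a b h ε) (x : ℝ) :
    (π ^ 2 * ((ε * M) ^ 2)⁻¹ + ((ε ^ α) ^ 2)⁻¹ * (2 * π ^ 2 * c' / M ^ 3 * |x / ε ^ α| ^ m)) *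
      ∫ y, ψ (x, y) ^ 2 ≤ ∫ y, dY ψ (x, y) ^ 2 := by
  obtain ⟨s1, s2⟩ := scal_eq hm hα hε
  have hA : 0 < ε ^ α := rpow_pos_of_pos hε _
  have hy : 0 < ε ^ (α * m) := rpow_pos_of_pos hε _
  have hout : ∀ s, (x, s) ∉ dom a b h ε → ψ (x, s) = 0 := fun s hs' => by
    by_contra hne
    exact hs' (hs (subset_tsupport _ hne))
  by_cases hz : ∀ s, ψ (x, s) = 0
  · simp only [hz]
    simp
    positivity
  · push Not at hz
    obtain ⟨s0, hs0⟩ := hz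
    have hmem : (x, s0) ∈ dom a b h ε := hs (subset_tsupport _ hs0)
    obtain ⟨hx, hp, hl⟩ := hmem
    simp only at hx hp hl
    have hεh : 0 < ε * h x := hp.trans hl
    have hh : 0 < h x := by
      by_contra hn; push Not at hn
      nlinarith
    have hP := poincareL (f := fun s => ψ (x, s)) ((slice_contDiff hψ.1 x).of_le (by norm_cast)) hεh
      (fun s hs' => hout s (fun hmem => hs' ⟨hmem.2.1, hmem.2.2⟩))
    refine le_trans (mul_le_mul_of_nonneg_right ?_ (by positivity)) hP
    have h1 := inv_sq_lower hh (d := c' * |x| ^ m) (by positivity) hM (hglob x hx)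
    have h2 : |x / ε ^ α| ^ m = |x| ^ m / ε ^ (α * m) := by
      rw [abs_div, abs_of_pos hA, div_rpow (abs_nonneg _) hA.le, s1]
    have h3 : ((ε ^ α) ^ 2)⁻¹ = ε ^ (α * m) * (ε ^ 2)⁻¹ := by rw [← s2]; field_simp
    rw [h2, h3]
    have h4 := mul_le_mul_of_nonneg_left h1 (by positivity : 0 ≤ π ^ 2 * (ε ^ 2)⁻¹)
    calc _ = π ^ 2 * (ε ^ 2)⁻¹ * (1 / M ^ 2 + 2 * (c' * |x| ^ m) / M ^ 3) := by
          field_simp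
      _ ≤ _ := h4
      _ = _ := by field_simp

lemma exists_bump : ∃ (Z : ℝ → ℝ) (C : ℝ), ContDiff ℝ (⊤ : ℕ∞) Z ∧ (∀ x, 0 ≤ Z x) ∧ (∀ x, Z x ≤ 1) ∧
    0 < C ∧ (∀ x, |deriv Z x| ≤ C) ∧ (∀ x, Z x ≠ 1 → 1 / 2 ≤ |x|) ∧ (∀ x, 1 ≤ |x| → Z x = 0) := by
  let f : ContDiffBump (0:ℝ) := ⟨1 / 2, 1, by norm_num, by norm_num⟩
  have hd : Continuous (deriv f) := (f.contDiff (n := 1)).continuous_deriv (by simp)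
  have hc : HasCompactSupport (deriv f) := f.hasCompactSupport.deriv
  obtain ⟨C, hC⟩ := hd.bounded_above_of_compact_support hc
  refine ⟨f, |C| + 1, f.contDiff, fun x => f.nonneg, fun x => f.le_one, by positivity, ?_, ?_, ?_⟩
  · intro x; have := hC x; rw [norm_eq_abs] at this; linarith [le_abs_self C]
  · intro x hx
    by_contra hn; push Not at hn
    exact hx (f.one_of_mem_closedBall (by simpa [f] using hn.le))
  · intro x hx
    exact f.zero_of_le_dist (by simpa [f] using hx)

/-- truncation step -/
lemma trunc_step {a b : ℝ} {h : ℝ → ℝ} {m α M c' : ℝ} (hm : 1 ≤ m) (hα : α = 2 / (m + 2))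
    (hM : 0 < M) (hc' : 0 < c') (hglob : ∀ x ∈ Icc (-a) b, h x ≤ M - c' * |x| ^ m)
    {B δ : ℝ} (hB : 0 ≤ B) (hδ : 0 < δ) : ∃ R : ℝ, 0 < R ∧ ∀ ε, 0 < ε → ∀ Λ, Λ ≤ B → ∀ j,
      Good2 (dom a b h ε) j (π ^ 2 * ((ε * M) ^ 2)⁻¹ + ((ε ^ α) ^ 2)⁻¹ * Λ) →
      ∃ F : Submodule ℝ ((ℝ × ℝ) → ℝ), Module.finrank ℝ F = j ∧
        (∀ ψ ∈ F, SC ψ ∧ (∀ p, p ∉ dom a b h ε → ψ p = 0) ∧ ∀ p : ℝ × ℝ, p.1 / ε ^ α ∉ Icc (-R) R → ψ p = 0) ∧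
        ∀ ψ ∈ F, ∫ p, gradSq ψ p ≤
          (π ^ 2 * ((ε * M) ^ 2)⁻¹ + ((ε ^ α) ^ 2)⁻¹ * (Λ + δ)) * ∫ p, ψ p ^ 2 := by
  obtain ⟨Z, C, hZ, hZ0, hZ1, hC, hZd, hZi, hZo⟩ := exists_bump
  set C1 : ℝ := 2 * π ^ 2 * c' / M ^ 3 with hC1
  have hC1p : 0 < C1 := by have := pi_pos; positivity
  have t1 : Tendsto (fun R : ℝ => C1 * (R / 2) ^ m) atTop atTop :=
    ((tendsto_rpow_atTop (by linarith)).comp (tendsto_id.atTop_div_const (by norm_num))).const_mul_atTop hC1p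
  have t2 : Tendsto (fun R : ℝ => C * R⁻¹) atTop (nhds 0) := by
    simpa using tendsto_inv_atTop_zero.const_mul C
  have t3 : Tendsto (fun R : ℝ => C * R⁻¹ * (B + 1) + (C * R⁻¹) ^ 2) atTop (nhds 0) := by
    simpa using (t2.mul_const (B + 1)).add (t2.pow 2)
  obtain ⟨R, ⟨⟨⟨r1, r2⟩, r3⟩, r4⟩⟩ := (((t1.eventually_ge_atTop (2 * B)).and
    (t1.eventually_ge_atTop ((B + δ) * B / (δ / 2)))).and
    (t3.eventually_le_const (by positivity : 0 < δ / 2))).and (eventually_gt_atTop 0) |>.exists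
  refine ⟨R, r4, ?_⟩
  rintro ε hε Λ hΛ j ⟨F, hF, hFS, hFE⟩
  have hA : 0 < ε ^ α := rpow_pos_of_pos hε _
  set A := ε ^ α with hAdef
  let ζ : ℝ → ℝ := fun x => Z (x / (A * R))
  have key : ∀ ψ ∈ F, _ := fun ψ hψ => trunc_core (hFS ψ hψ).1 (c0 := π ^ 2 * ((ε * M) ^ 2)⁻¹) (A := A)
    (Λ := Λ) (B := B) (κ := C * R⁻¹) (G0 := C1 * (R / 2) ^ m) (δ := δ)
    (G := fun x => C1 * |x / A| ^ m) (ζ := ζ) hA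
    (by
      have : Continuous fun x : ℝ => |x / A| := by fun_prop
      exact continuous_const.mul (this.rpow_const (fun x => Or.inr (by linarith))))
    (fun x => by positivity) (by fun_prop) (fun x => hZ0 _) (fun x => hZ1 _) (by positivity)
    (by
      intro x
      have h1 : HasDerivAt ζ (deriv Z (x / (A * R)) * (1 / (A * R))) x :=
        HasDerivAt.comp x (hZ.differentiable (by simp) _).hasDerivAt ((hasDerivAt_id x).div_const _)
      rw [h1.deriv, abs_mul, abs_of_pos (by positivity : 0 < 1 / (A * R))]
      calc _ ≤ C * (1 / (A * R)) := by gcongr; exact hZd _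
        _ = _ := by field_simp)
    (by
      intro x hx
      have h1 := hZi _ hx
      rw [abs_div, abs_of_pos (by positivity : 0 < A * R), le_div_iff₀ (by positivity)] at h1
      have h2 : R / 2 ≤ |x / A| := by
        rw [abs_div, abs_of_pos hA, le_div_iff₀ hA]; linarith
      gcongr)
    (by positivity) (fib_bound hm hα hM hc' hε hglob (hFS ψ hψ).1 (hFS ψ hψ).2) (hFE ψ hψ) hΛ hB hδ
    r1 (by rw [div_le_iff₀ (by positivity)] at r2; exact r2) r3
  let T : ((ℝ × ℝ) → ℝ) →ₗ[ℝ] ((ℝ × ℝ) → ℝ) :=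
    { toFun := fun ψ p => ζ p.1 * ψ p
      map_add' := by intro f g; funext p; simp; ring
      map_smul' := by intro c f; funext p; simp; ring }
  refine ⟨F.map T, ?_, ?_, ?_⟩
  · rw [finrank_map_inj T F, hF]
    intro ψ hψ hT
    by_contra hne
    have h1 := (key ψ hψ).2.1
    have h2 : ∀ p : ℝ × ℝ, ζ p.1 * ψ p = 0 := fun p => congrFun hT p
    simp only [h2] at h1
    have h3 := integral_sq_pos (μ := volume) (hFS ψ hψ).1.cont (hFS ψ hψ).1.2 hne
    simp at h1
    linarith
  · rintro _ ⟨ψ, hψ, rfl⟩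
    refine ⟨(key ψ hψ).1, ?_, ?_⟩
    · intro p hp
      have : ψ p = 0 := by
        by_contra hne
        exact hp ((hFS ψ hψ).2 (subset_tsupport _ hne))
      change ζ p.1 * ψ p = 0
      rw [this, mul_zero]
    · intro p hp
      have h1 : R ≤ |p.1 / A| := by
        by_contra hn; push Not at hn
        exact hp (abs_le.1 hn.le)
      have : ζ p.1 = 0 := by
        apply hZo
        rw [← div_div, abs_div, abs_of_pos r4, le_div_iff₀ r4]; linarith
      change ζ p.1 * ψ p = 0
      rw [this, zero_mul]
  · rintro _ ⟨ψ, hψ, rfl⟩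
    exact (key ψ hψ).2.2

lemma sco_int {u : ℝ × ℝ → ℝ} (hu : SC u) (t : ℝ) : Integrable (fun s => u (t, s) * sin (π * s)) := by
  have h1 : Continuous fun s => u (t, s) * sin (π * s) := by have := hu.cont; fun_prop
  exact h1.integrable_of_hasCompactSupport ((slice_cs hu.2 t).mul_right)

lemma sco_add {u v : ℝ × ℝ → ℝ} (hu : SC u) (hv : SC v) (t : ℝ) : sco (u + v) t = sco u t + sco v t := by
  unfold sco
  rw [← integral_add (sco_int hu t) (sco_int hv t)]
  congr 1; funext s; simp; ring

lemma sco_smul (c : ℝ) (u : ℝ × ℝ → ℝ) (t : ℝ) : sco (c • u) t = c * sco u t := by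
  unfold sco
  rw [← integral_const_mul]
  congr 1; funext s; simp; ring

set_option maxHeartbeats 1000000 in
lemma lower {a b : ℝ} {h V q : ℝ → ℝ} {m α K η M c' : ℝ} {j : ℕ}
    (hm : 1 ≤ m) (hα : α = 2 / (m + 2)) (hM : 0 < M) (hη : 0 < η) (hK : 0 < K)
    (hV : Continuous V) (hV0 : ∀ t, 0 ≤ V t) (hVh : ∀ A t, 0 < A → V (A * t) = A ^ m * V t)
    (hexp : ∀ x, |x| ≤ η → |h x - (M - V x)| ≤ K * |x| ^ (m + 1))
    (hq : q = fun t => 2 * π ^ 2 * V t / M ^ 3) (hc' : 0 < c')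
    (hglob : ∀ x ∈ Icc (-a) b, h x ≤ M - c' * |x| ^ m)
    {B δ : ℝ} (hB : 0 ≤ B) (hδ : 0 < δ) :
    ∀ᶠ ε in nhdsWithin (0:ℝ) (Ioi 0), ∀ Λ, Λ ≤ B →
      Good2 (dom a b h ε) j (π ^ 2 * ((ε * M) ^ 2)⁻¹ + ((ε ^ α) ^ 2)⁻¹ * Λ) → Good1 q j (Λ + δ) := by
  have hπ := pi_pos
  have hqc : Continuous q := by rw [hq]; fun_prop
  have hq0 : ∀ t, 0 ≤ q t := by intro t; rw [hq]; have := hV0 t; positivity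
  obtain ⟨R, hR, hT⟩ := trunc_step (a := a) (b := b) hm hα hM hc' hglob hB (δ := δ / 2) (by positivity)
  set δ' : ℝ := δ * M ^ 3 / (24 * π ^ 2) with hδ'
  have hδ'p : 0 < δ' := by positivity
  obtain ⟨P, hP, hPa, Q, hQ, hPB⟩ := poly_approx (f := fun t => V t - δ') (by fun_prop) R
    (δ := δ' / 2) (by positivity)
  have e2 := scal_ev hm hα (ev_lt (f := fun z => z.1 * R) (c := η) (by fun_prop) (by simpa using hη))
  have e3 := scal_ev hm hα (ev_lt (f := fun z => z.1 * (K * R ^ (m + 1)))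
    (c := δ' / 2) (by fun_prop) (by simpa using hδ'p))
  have e4 := scal_ev hm hα (ev_lt (f := fun z => z.2 * (Q / M))
    (c := 1 / 4) (by fun_prop) (by simp))
  have e5 := scal_ev hm hα (ev_lt (f := fun z => 4 * (z.2 * (Q / M)) * M ^ 2 * z.2)
    (c := 1 / 4) (by fun_prop) (by simp))
  have e6 := scal_ev hm hα (ev_lt (f := fun z => 8 * (z.2 * (Q / M)) * π ^ 2)
    (c := δ / 8) (by fun_prop) (by simpa using hδ))
  have e7 := scal_ev hm hα (ev_lt (f := fun z => (z.2 * (Q / M)) * (1 / 2 + B + δ))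
    (c := δ / 4) (by fun_prop) (by simpa using hδ))
  have e8 := scal_ev hm hα (ev_lt (f := fun z => z.2 * (B + δ / 2 + (z.2 * (Q / M)) / 2))
    (c := π ^ 2 * (M ^ 2)⁻¹ / 2) (by fun_prop) (by simp; positivity))
  filter_upwards [e2, e3, e4, e5, e6, e7, e8, self_mem_nhdsWithin] with ε e2 e3 e4 e5 e6 e7 e8 hε
  have hε : 0 < ε := hε
  intro Λ hΛ hG
  obtain ⟨F, hF, hFS, hFE⟩ := hT ε hε Λ hΛ j hG
  obtain ⟨s1, s2⟩ := scal_eq hm hα hε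
  have hA : 0 < ε ^ α := rpow_pos_of_pos hε _
  have hy : 0 < ε ^ (α * m) := rpow_pos_of_pos hε _
  set A := ε ^ α
  set y := ε ^ (α * m)
  let w : ℝ → ℝ := fun t => y / M * P t
  have hw : ContDiff ℝ (⊤ : ℕ∞) w := contDiff_const.mul hP
  have hwb : ∀ t ∈ Icc (-R) R, |w t| ≤ y * (Q / M) := by
    intro t ht
    simp only [w]
    rw [abs_mul, abs_of_pos (by positivity)]
    calc y / M * |P t| ≤ y / M * Q := by gcongr; exact (hPB t ht).1
      _ = _ := by ring
  have hwl : ∀ t ∈ Icc (-R) R, 1 / 2 ≤ exp (2 * w t) := by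
    intro t ht
    have := abs_le.1 (hwb t ht)
    linarith [add_one_le_exp (2 * w t)]
  have hwu : ∀ t ∈ Icc (-R) R, exp (2 * w t) ≤ 2 := by
    intro t ht
    have h1 := abs_le.1 (hwb t ht)
    have h2 := exp_le_quad (x := 2 * w t) (abs_le.2 ⟨by linarith, by linarith⟩)
    nlinarith
  have hyA : (A ^ 2)⁻¹ = y * (ε ^ 2)⁻¹ := by
    rw [← s2]; field_simp
  have hLL : ((ε * M) ^ 2)⁻¹ = (M ^ 2)⁻¹ * (ε ^ 2)⁻¹ := by field_simp
  have hε2 : 0 < (ε ^ 2)⁻¹ := by positivity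
  have hκ : 0 < y * (Q / M) := by positivity
  set κ := y * (Q / M) with hκd
  have hhle : ∀ t ∈ Icc (-R) R, h (A * t) ≤ M * exp (-w t) := by
    intro t ht
    have hAt : |A * t| ≤ A * R := by
      rw [abs_mul, abs_of_pos hA]; gcongr; exact abs_le.2 ht
    have h1 := (abs_le.1 (hexp (A * t) (by linarith))).2
    have h2 : |A * t| ^ (m + 1) ≤ (A * R) ^ (m + 1) := by gcongr
    have h3 : (A * R) ^ (m + 1) = y * (A * R ^ (m + 1)) := by
      rw [mul_rpow hA.le hR.le, rpow_add hA, s1, rpow_one]; ring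
    rw [hVh A t hA, s1] at h1
    have h5 : M * (-w t + 1) ≤ M * exp (-w t) :=
      mul_le_mul_of_nonneg_left (add_one_le_exp _) hM.le
    have h6 : M * w t = y * P t := by simp only [w]; field_simp
    have h8 := (abs_le.1 (hPa t ht)).2
    have h9 : K * |A * t| ^ (m + 1) ≤ y * (A * (K * R ^ (m + 1))) := by
      calc _ ≤ K * (A * R) ^ (m + 1) := by gcongr
        _ = _ := by rw [h3]; ring
    have h10 : y * (A * (K * R ^ (m + 1))) ≤ y * (δ' / 2) := by gcongr
    have h11 : y * P t ≤ y * (V t - δ' / 2) := by gcongr; linarith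
    linarith
  have key : ∀ ψ ∈ F, _ := fun ψ hψ => lower_core (hFS ψ hψ).1 (A := A) (L := ε * M) (R := R)
    (Λ := Λ + δ / 2) (κ := κ) (s := 4 * κ * M ^ 2 * y) (δ := δ / 2) (δ₂ := δ / 4) (w := w) (q := q)
    hA (by positivity) hw hqc hq0 hκ.le (by linarith)
    (by
      intro t σ hσ
      simp only [trf]
      by_contra hne
      have hne := right_ne_zero_of_mul hne
      have hd : (A * t, ε * M * exp (-w t) * σ) ∈ dom a b h ε := by
        by_contra hd; exact hne ((hFS ψ hψ).2.1 _ hd)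
      have hd2 : t ∈ Icc (-R) R := by
        by_contra hd2
        apply hne
        apply (hFS ψ hψ).2.2
        simp only
        rwa [mul_div_cancel_left₀ _ hA.ne']
      obtain ⟨-, d2, d3⟩ := hd
      simp only at d2 d3
      have hcp : 0 < ε * M * exp (-w t) := by positivity
      have hσ0 : 0 < σ := (mul_pos_iff_of_pos_left hcp).1 d2
      have hσ1 : 1 ≤ σ := by
        by_contra hn; push Not at hn; exact hσ ⟨hσ0, hn⟩
      have h1 := mul_le_mul_of_nonneg_left (hhle t hd2) hε.le
      nlinarith)
    (by
      intro t ht σ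
      simp only [trf]
      rw [(hFS ψ hψ).2.2, mul_zero]
      simp only
      rwa [mul_div_cancel_left₀ _ hA.ne'])
    (by
      intro t ht
      have : deriv w t = y / M * deriv P t := deriv_const_mul _ (hP.differentiable (by simp) t)
      rw [this, abs_mul, abs_of_pos (by positivity)]
      calc y / M * |deriv P t| ≤ y / M * Q := by gcongr; exact (hPB t ht).2
        _ = _ := by rw [hκd]; ring)
    (by
      intro t ht
      rw [hyA, hLL]
      have h1 := mul_le_mul_of_nonneg_left (hwl t ht) (by positivity : 0 ≤ 4 * κ * y * (ε ^ 2)⁻¹)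
      calc _ = 4 * κ * y * (ε ^ 2)⁻¹ * (1 / 2) := by ring
        _ ≤ _ := h1
        _ = _ := by field_simp)
    (by linarith)
    (by
      intro t ht
      rw [hyA, hLL]
      suffices hh : π ^ 2 * (M ^ 2)⁻¹ + y * (q t - δ / 4) ≤
          (1 - 4 * κ * M ^ 2 * y) * (π ^ 2 * ((M ^ 2)⁻¹ * exp (2 * w t))) by
        have := mul_le_mul_of_nonneg_right hh hε2.le
        linarith
      have h1 : 4 * κ * M ^ 2 * y * (π ^ 2 * ((M ^ 2)⁻¹ * exp (2 * w t))) ≤ y * (δ / 8) := by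
        calc _ = 4 * κ * π ^ 2 * y * exp (2 * w t) := by field_simp
          _ ≤ 4 * κ * π ^ 2 * y * 2 := by gcongr; exact hwu t ht
          _ = y * (8 * κ * π ^ 2) := by ring
          _ ≤ _ := by gcongr
      have h2 : π ^ 2 * (M ^ 2)⁻¹ * (2 * w t + 1) ≤ π ^ 2 * (M ^ 2)⁻¹ * exp (2 * w t) :=
        mul_le_mul_of_nonneg_left (add_one_le_exp _) (by positivity)
      have h3 : y * (q t - δ / 8) ≤ π ^ 2 * (M ^ 2)⁻¹ * (2 * w t) := by
        have : π ^ 2 * (M ^ 2)⁻¹ * (2 * w t) = y * (2 * π ^ 2 / M ^ 3 * P t) := by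
          simp only [w]; field_simp
        rw [this]
        apply mul_le_mul_of_nonneg_left _ hy.le
        have h8 := (abs_le.1 (hPa t ht)).1
        calc q t - δ / 8 = 2 * π ^ 2 / M ^ 3 * (V t - 3 * δ' / 2) := by
              rw [hq, hδ']; field_simp; ring
          _ ≤ _ := by gcongr; linarith
      linarith)
    (by
      intro t ht
      rw [hLL]
      have h1 := hwl t ht
      have h2 : 3 / 2 ≤ (1 - 4 * κ * M ^ 2 * y) * (4 * exp (2 * w t)) := by
        have h3 : (3 / 4 : ℝ) * (4 * (1 / 2)) ≤ (1 - 4 * κ * M ^ 2 * y) * (4 * exp (2 * w t)) :=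
          mul_le_mul (by linarith) (by linarith) (by norm_num) (by linarith)
        linarith
      have := mul_le_mul_of_nonneg_right h2 (by positivity : 0 ≤ (M ^ 2)⁻¹ * (ε ^ 2)⁻¹)
      linarith)
    (hFE ψ hψ)
    (by
      rw [hyA, hLL]
      have h1 : y * (Λ + δ / 2 + κ / 2) ≤ y * (B + δ / 2 + κ / 2) := by gcongr
      have h2 := mul_lt_mul_of_pos_right (h1.trans_lt e8) hε2
      linarith)
    (by
      have h1 : κ * Λ ≤ κ * B := mul_le_mul_of_nonneg_left hΛ hκ.le
      linarith)
  have htr : ∀ ψ ∈ F, SC (trf A (ε * M) w ψ) := fun ψ hψ => SC.trf_sc hA (by positivity) hw (hFS ψ hψ).1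
  let S : F →ₗ[ℝ] (ℝ → ℝ) :=
    { toFun := fun ψ t => √2 * sco (trf A (ε * M) w (ψ : ℝ × ℝ → ℝ)) t
      map_add' := by
        intro f g
        funext t
        have : trf A (ε * M) w ((f + g : F) : ℝ × ℝ → ℝ) = trf A (ε * M) w (f : ℝ × ℝ → ℝ) + trf A (ε * M) w (g : ℝ × ℝ → ℝ) := by
          funext p; simp [trf]; ring
        simp only [Pi.add_apply]
        rw [this, sco_add (htr _ f.2) (htr _ g.2)]; ring
      map_smul' := by
        intro c f
        funext t
        have : trf A (ε * M) w ((c • f : F) : ℝ × ℝ → ℝ) = c • trf A (ε * M) w (f : ℝ × ℝ → ℝ) := by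
          funext p; simp [trf]; ring
        simp only [Pi.smul_apply, RingHom.id_apply, smul_eq_mul]
        rw [this, sco_smul]; ring }
  refine ⟨LinearMap.range S, ?_, ?_, ?_⟩
  · rw [LinearMap.finrank_range_of_inj, hF]
    rw [← LinearMap.ker_eq_bot, LinearMap.ker_eq_bot']
    intro ψ hψ
    exact Subtype.ext ((key ψ ψ.2).2 (fun t => congrFun hψ t))
  · rintro _ ⟨ψ, rfl⟩
    have h1 := sco_SC (htr _ ψ.2)
    exact ⟨contDiff_const.mul h1.1, h1.2.mul_left⟩
  · rintro _ ⟨ψ, rfl⟩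
    have h1 := (key ψ ψ.2).1
    have h2 : Λ + δ / 2 + δ / 2 = Λ + δ := by ring
    rw [h2] at h1
    exact h1

noncomputable def VV (cp cm m : ℝ) (t : ℝ) : ℝ := cp * (max t 0) ^ m + cm * (max (-t) 0) ^ m

lemma VV_pos {cp cm m t : ℝ} (hm : 1 ≤ m) (ht : 0 ≤ t) : VV cp cm m t = cp * t ^ m := by
  unfold VV
  rw [max_eq_left ht, max_eq_right (by linarith), zero_rpow (by linarith)]; ring

lemma VV_neg {cp cm m t : ℝ} (hm : 1 ≤ m) (ht : t ≤ 0) : VV cp cm m t = cm * |t| ^ m := by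
  unfold VV
  rw [max_eq_right ht, max_eq_left (by linarith), zero_rpow (by linarith), abs_of_nonpos ht]; ring

lemma VV_cont {cp cm m : ℝ} (hm : 1 ≤ m) : Continuous (VV cp cm m) := by
  unfold VV
  have h1 : Continuous fun t : ℝ => (max t 0) ^ m :=
    (by fun_prop : Continuous fun t : ℝ => max t 0).rpow_const (fun x => Or.inr (by linarith))
  have h2 : Continuous fun t : ℝ => (max (-t) 0) ^ m :=
    (by fun_prop : Continuous fun t : ℝ => max (-t) 0).rpow_const (fun x => Or.inr (by linarith))
  exact (continuous_const.mul h1).add (continuous_const.mul h2)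

lemma VV_hom {cp cm m : ℝ} (hm : 1 ≤ m) (A t : ℝ) (hA : 0 < A) :
    VV cp cm m (A * t) = A ^ m * VV cp cm m t := by
  rcases le_total 0 t with ht | ht
  · rw [VV_pos hm ht, VV_pos hm (by positivity), mul_rpow hA.le ht]; ring
  · rw [VV_neg hm ht, VV_neg hm (mul_nonpos_of_nonneg_of_nonpos hA.le ht), abs_mul, abs_of_pos hA,
      mul_rpow hA.le (abs_nonneg _)]; ring

lemma VV_ge {cp cm m : ℝ} (hm : 1 ≤ m) (t : ℝ) : min cp cm * |t| ^ m ≤ VV cp cm m t := by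
  rcases le_total 0 t with ht | ht
  · rw [VV_pos hm ht, abs_of_nonneg ht]; gcongr; exact min_le_left _ _
  · rw [VV_neg hm ht]; gcongr; exact min_le_right _ _

lemma glob_bound {a b : ℝ} (ha : 0 < a) (hb : 0 < b) {h V : ℝ → ℝ} {m K η c : ℝ}
    (hcont : ContinuousOn h (Icc (-a) b)) (hmax : ∀ x ∈ Icc (-a) b, x ≠ 0 → h x < h 0)
    (hm : 1 ≤ m) (hη : 0 < η) (hK : 0 < K) (hc : 0 < c) (hV : ∀ t, c * |t| ^ m ≤ V t)
    (hexp : ∀ x, |x| ≤ η → |h x - (h 0 - V x)| ≤ K * |x| ^ (m + 1)) :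
    ∃ c', 0 < c' ∧ ∀ x ∈ Icc (-a) b, h x ≤ h 0 - c' * |x| ^ m := by
  set η1 := min η (c / (2 * K))
  have hη1 : 0 < η1 := lt_min hη (by positivity)
  have hS : IsCompact (Icc (-a) b ∩ {x | η1 ≤ |x|}) :=
    isCompact_Icc.inter_right (isClosed_le continuous_const continuous_abs)
  obtain ⟨d, hd, hdS⟩ := hS.exists_forall_le' (f := fun x => h 0 - h x) (a := 0)
    (continuousOn_const.sub (hcont.mono inter_subset_left)) (by
      rintro x ⟨hx, hx2⟩
      have : x ≠ 0 := by rintro rfl; simp at hx2; linarith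
      linarith [hmax x hx this])
  refine ⟨min (c / 2) (d / (a + b) ^ m), lt_min (by positivity) (by positivity), ?_⟩
  intro x hx
  rcases le_total η1 |x| with h1 | h1
  · have h2 := hdS x ⟨hx, h1⟩
    have h3 : |x| ≤ a + b := abs_le.2 ⟨by linarith [hx.1], by linarith [hx.2]⟩
    have h4 : min (c / 2) (d / (a + b) ^ m) * |x| ^ m ≤ d := by
      calc _ ≤ d / (a + b) ^ m * (a + b) ^ m := by gcongr; exact min_le_right _ _
        _ = d := by field_simp
    linarith
  · have h2 := (abs_le.1 (hexp x (h1.trans (min_le_left _ _)))).2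
    have h3 : K * |x| ^ (m + 1) ≤ c / 2 * |x| ^ m := by
      rw [rpow_add_one' (abs_nonneg _) (by linarith)]
      have h4 : |x| ≤ c / (2 * K) := h1.trans (min_le_right _ _)
      rw [le_div_iff₀ (by positivity)] at h4
      have h5 : 0 ≤ |x| ^ m := by positivity
      nlinarith
    have h4 := hV x
    have h5 : min (c / 2) (d / (a + b) ^ m) * |x| ^ m ≤ c / 2 * |x| ^ m := by
      gcongr; exact min_le_left _ _
    linarith

/-- **Remark 6.1** (Friedlander–Solomyak). The two-term asymptotics
`lim_{ε→0⁺} ε^{2α} (λ_j(ε) − π²/(M²ε²)) = μ_j` persist when `h` is merely continuous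
on `I = [-a,b]`, positive on the open interval `(-a,b)` (possibly vanishing at the
endpoints), `C¹` on a punctured neighborhood of `0`, with the same conditions (i),
(ii) near the maximum point `x = 0`. -/
theorem dirichlet_laplacian_vanishing_endpoints_two_term_asymptotics
    (a b : ℝ) (ha : 0 < a) (hb : 0 < b)
    (h : ℝ → ℝ)
    (hcont : ContinuousOn h (Icc (-a) b))
    (hpos : ∀ x ∈ Ioo (-a) b, 0 < h x)
    (hmax : ∀ x ∈ Icc (-a) b, x ≠ 0 → h x < h 0)
    (hC1 : ∃ δ : ℝ, 0 < δ ∧ ContDiffOn ℝ 1 h (Ioo (-δ) δ \ {0}))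
    (m cp cm K η : ℝ)
    (hm : 1 ≤ m) (hcp : 0 < cp) (hcm : 0 < cm) (hK : 0 < K) (hη : 0 < η)
    (hexp_pos : ∀ x : ℝ, 0 < x → x ≤ η →
      |h x - (h 0 - cp * x ^ m)| ≤ K * x ^ (m + 1))
    (hexp_neg : ∀ x : ℝ, -η ≤ x → x < 0 →
      |h x - (h 0 - cm * |x| ^ m)| ≤ K * |x| ^ (m + 1))
    (α : ℝ) (hα : α = 2 / (m + 2))
    (q : ℝ → ℝ)
    (hq_pos : ∀ x : ℝ, 0 < x → q x = 2 * π ^ 2 * cp * x ^ m / (h 0) ^ 3)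
    (hq_neg : ∀ x : ℝ, x ≤ 0 → q x = 2 * π ^ 2 * cm * |x| ^ m / (h 0) ^ 3)
    (j : ℕ) (hj : 1 ≤ j) :
    Tendsto
      (fun ε : ℝ =>
        ε ^ (2 * α) *
          (dirichletMinMax {p : ℝ × ℝ | p.1 ∈ Icc (-a) b ∧ 0 < p.2 ∧ p.2 < ε * h p.1} j
            - π ^ 2 / ((h 0) ^ 2 * ε ^ 2)))
      (nhdsWithin 0 (Ioi 0)) (nhds (schroedingerMinMax q j)) := by
  have hM : 0 < h 0 := hpos 0 ⟨by linarith, hb⟩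
  have hV := VV_cont (cp := cp) (cm := cm) hm
  have hVg := VV_ge (cp := cp) (cm := cm) hm
  have hc : 0 < min cp cm := lt_min hcp hcm
  have hV0 : ∀ t, 0 ≤ VV cp cm m t := fun t => le_trans (by positivity) (hVg t)
  have hVh := VV_hom (cp := cp) (cm := cm) hm
  have hexp : ∀ x, |x| ≤ η → |h x - (h 0 - VV cp cm m x)| ≤ K * |x| ^ (m + 1) := by
    intro x hx
    rcases lt_trichotomy x 0 with h1 | h1 | h1
    · rw [VV_neg hm h1.le]; exact hexp_neg x (by linarith [(abs_le.1 hx).1]) h1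
    · subst h1
      rw [VV_pos hm le_rfl, zero_rpow (by linarith)]; simp; positivity
    · rw [VV_pos hm h1.le, abs_of_pos h1]; exact hexp_pos x h1 (by linarith [(abs_le.1 hx).2])
  have hq : q = fun t => 2 * π ^ 2 * VV cp cm m t / (h 0) ^ 3 := by
    funext t
    rcases lt_or_ge 0 t with h1 | h1
    · rw [VV_pos hm h1.le, hq_pos t h1]; ring
    · rw [VV_neg hm h1, hq_neg t h1]; ring
  obtain ⟨c', hc', hglob⟩ := glob_bound ha hb hcont hmax hm hη hK hc hVg hexp
  have hqc : Continuous q := by rw [hq]; fun_prop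
  have hq0 : ∀ t, 0 ≤ q t := by intro t; rw [hq]; have := hV0 t; have := pi_pos; positivity
  obtain ⟨A₀, hA₀⟩ := exists_good1 hqc hj
  set μ := schroedingerMinMax q j with hμ
  have hup : ∀ δ, 0 < δ → ∀ᶠ ε in nhdsWithin (0:ℝ) (Ioi 0), Good2 (dom a b h ε) j
      (π ^ 2 * ((ε * h 0) ^ 2)⁻¹ + ((ε ^ α) ^ 2)⁻¹ * (μ + δ)) := by
    intro δ hδ
    have h1 : Good1 q j (μ + δ / 2) := schr_lt hqc hj hA₀ (by linarith)
    have h2 := upper ha hb hj hm hα hM hη hK hV hV0 hVh hexp hq h1 (half_pos hδ)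
    filter_upwards [h2] with ε h2
    have : μ + δ / 2 + δ / 2 = μ + δ := by ring
    rwa [this] at h2
  have hconv : ∀ ε : ℝ, 0 < ε → ∀ l r, (ε ^ (2 * α) * (l - π ^ 2 / ((h 0) ^ 2 * ε ^ 2)) ≤ r ↔
      l ≤ π ^ 2 * ((ε * h 0) ^ 2)⁻¹ + ((ε ^ α) ^ 2)⁻¹ * r) := by
    intro ε hε l r
    have hA : 0 < ε ^ α := rpow_pos_of_pos hε _
    have h1 : ε ^ (2 * α) = (ε ^ α) ^ 2 := by
      rw [← rpow_natCast (ε ^ α) 2, ← rpow_mul hε.le]; congr 1; push_cast; ring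
    have h2 : π ^ 2 * ((ε * h 0) ^ 2)⁻¹ = π ^ 2 / ((h 0) ^ 2 * ε ^ 2) := by field_simp
    rw [h1, h2, ← sub_le_iff_le_add', inv_mul_eq_div, le_div_iff₀ (by positivity), mul_comm]
  refine tendsto_order.2 ⟨?_, ?_⟩
  · intro l hl
    have hB : 0 ≤ |μ| + 1 := by positivity
    have hδ : 0 < (μ - l) / 3 := by linarith
    have h2 := lower (a := a) (b := b) (j := j) hm hα hM hη hK hV hV0 hVh hexp hq hc' hglob hB hδ
    filter_upwards [hup 1 one_pos, h2, self_mem_nhdsWithin] with ε h1 h2 hε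
    by_contra hn
    push Not at hn
    rw [hconv ε hε] at hn
    have h3 : dirichletMinMax (dom a b h ε) j <
        π ^ 2 * ((ε * h 0) ^ 2)⁻¹ + ((ε ^ α) ^ 2)⁻¹ * (l + (μ - l) / 3) := by
      refine lt_of_le_of_lt hn ?_
      have hA : 0 < ε ^ α := rpow_pos_of_pos hε _
      have : 0 < ((ε ^ α) ^ 2)⁻¹ := by positivity
      have : 0 < ((ε ^ α) ^ 2)⁻¹ * ((μ - l) / 3) := by positivity
      linarith
    have h4 := dirichlet_lt hj h1 h3
    have h5 := h2 _ (by linarith [le_abs_self μ]) h4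
    have h6 := schr_le hq0 hj h5
    linarith
  · intro u hu
    filter_upwards [hup ((u - μ) / 2) (by linarith), self_mem_nhdsWithin] with ε h1 hε
    refine lt_of_le_of_lt ((hconv ε hε _ (μ + (u - μ) / 2)).2 (dirichlet_le hj h1)) (by linarith)
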